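/- arXiv:math/0605168 — 9 statements merged into one kernel-verified Lean document; each statement's English description precedes it below -/
import Mathlib

section
/- Let n ≥ 1 and let a_1,…,a_n, b_1,…,b_n, c_1,…,c_{n-1} be complex numbers. Let M be ANY n×n complex matrix whose entries satisfy M_{ij} = a_i b_j whenever i ≤ j, and M_{i+1,i} = c_i for i = 1,…,n−1 (the entries M_{ij} with i > j+1 are arbitrary). Then det M = a_1 · (∏_{k=1}^{n-1} (a_{k+1} b_k − c_k)) · b_n. -/
/-- The case of coefficient `1` in the first row, by clearing the second row with the first. -/
theorem det_of_first_row_of_upper_with_subdiagonal {R : Type*} [CommRing R] (n : ℕ)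
    (a : Fin n → R) (b : Fin (n + 1) → R) (c : Fin n → R)
    (M : Matrix (Fin (n + 1)) (Fin (n + 1)) R)
    (hrow : ∀ j, M 0 j = b j)
    (hup : ∀ (i : Fin n) (j : Fin (n + 1)), i.succ ≤ j → M i.succ j = a i * b j)
    (hsub : ∀ k : Fin n, M k.succ k.castSucc = c k) :
    M.det = (∏ k : Fin n, (a k * b k.castSucc - c k)) * b (Fin.last n) := by
  induction n with
  | zero => simp [hrow]
  | succ n ih =>
    have h10 : (1 : Fin (n + 2)) ≠ 0 := by simp
    have hM10 : M 1 0 = c 0 := hsub 0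
    have hM1 : ∀ j : Fin (n + 1), M 1 j.succ = a 0 * b j.succ := fun j =>
      hup 0 j.succ (Fin.succ_le_succ_iff.mpr (Fin.zero_le j))
    have hminor : (M.submatrix (Fin.succAbove 1) Fin.succ).det =
        (∏ k : Fin n, (a k.succ * b k.succ.castSucc - c k.succ)) * b (Fin.last (n + 1)) := by
      refine ih (fun k => a k.succ) (fun j => b j.succ) (fun k => c k.succ) _ ?_ ?_ ?_
      · intro j
        simp [hrow]
      · intro i j hij
        simpa using hup i.succ j.succ (Fin.succ_le_succ_iff.mpr hij)
      · intro k
        simpa using hsub k.succ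
    have hminor' : (M.updateRow 1 (M 1 + (-a 0) • M 0)).submatrix (Fin.succAbove 1) Fin.succ =
        M.submatrix (Fin.succAbove 1) Fin.succ := by
      ext i j
      simp
    rw [← Matrix.det_updateRow_add_smul_self M h10 (-a 0), Matrix.det_succ_row _ 1,
      Fin.sum_univ_succ, Finset.sum_eq_zero, Fin.succAbove_zero, hminor', hminor,
      Fin.prod_univ_succ]
    · simp [hM10, hrow]
      ring
    · intro j _
      simp [hM1, hrow]

/-- Lemma 1.2: determinant of a matrix whose upper-triangular part (including the
diagonal) is `a i * b j` and whose subdiagonal is `c`; entries strictly below the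
subdiagonal are arbitrary.  The size is `n + 1` with `n : ℕ`, so the matrix has
size at least `1`. -/
theorem det_rank_one_upper_with_subdiagonal (n : ℕ)
    (a b : Fin (n + 1) → ℂ) (c : Fin n → ℂ)
    (M : Matrix (Fin (n + 1)) (Fin (n + 1)) ℂ)
    (hup : ∀ i j : Fin (n + 1), i ≤ j → M i j = a i * b j)
    (hsub : ∀ k : Fin n, M k.succ k.castSucc = c k) :
    M.det = a 0 * (∏ k : Fin n, (a k.succ * b k.castSucc - c k)) * b (Fin.last n) := by
  rw [← Matrix.updateRow_eq_self M 0,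
    show M 0 = a 0 • b from funext fun j => hup 0 j (Fin.zero_le j),
    Matrix.det_updateRow_smul,
    det_of_first_row_of_upper_with_subdiagonal n (fun k => a k.succ) b c]
  · ring
  · simp
  · intro i j hij
    simpa using hup i.succ j hij
  · intro k
    simpa using hsub k
end

section
/- Let n ≥ 1, let a_1,…,a_n be complex numbers, and let q be an n×n complex matrix with q_{ij} = 0 whenever i ≥ j. Define the n×n matrix K by K_{ij} = a_i − q_{ji}. Then det K = a_1 · ∏_{k=1}^{n-1} q_{k,k+1}. -/
/-- The determinant computation at the heart of the proof of Theorem 1.1: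
if `q` is strictly upper triangular (`q i j = 0` for `j ≤ i`) and
`K i j = a i - q j i`, then `det K = a 0 * ∏ q (k, k+1)`.
The size is `n + 1` with `n : ℕ`, so the matrix has size at least `1`. -/
theorem det_kernel_minor (n : ℕ) (a : Fin (n + 1) → ℂ)
    (q : Matrix (Fin (n + 1)) (Fin (n + 1)) ℂ)
    (hq : ∀ i j : Fin (n + 1), j ≤ i → q i j = 0) :
    (Matrix.of fun i j : Fin (n + 1) => a i - q j i).det =
      a 0 * ∏ k : Fin n, q k.castSucc k.succ := by
  -- subtracting from each column its predecessor gives a lower triangular matrix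
  let B : Matrix (Fin (n + 1)) (Fin (n + 1)) ℂ := Matrix.of fun i j =>
    Fin.cases (a i - q 0 i) (fun k => q k.castSucc i - q k.succ i) j
  have hB : B.IsLowerTriangular := by
    intro i j hij
    have hij : i < j := hij
    induction j using Fin.cases with
    | zero => exact absurd hij (Fin.not_lt_zero i)
    | succ k =>
      have hik : i ≤ k.castSucc := Fin.le_castSucc_iff.mpr hij
      simp [B, hq _ _ hik, hq _ _ hij.le]
  rw [Matrix.det_eq_of_forall_col_eq_smul_add_pred (B := B) (fun _ => 1)
    (fun i => by simp [B]) (fun i j => by simp [B]),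
    Matrix.det_of_isLowerTriangular B hB, Fin.prod_univ_succ]
  simp [B, hq _ _ le_rfl]
end

section
/- Let 𝔛 be a countable set and P : 𝔛 × 𝔛 → [0,1] a stochastic matrix (∑_y P_{xy} = 1 for all x) that is loop-free: (P^k)_{xx} = 0 for all x ∈ 𝔛 and all k ≥ 1. Then for all x ≠ y in 𝔛 and every integer m ≥ 1, the partial sum ∑_{k=1}^{m} (P^k)_{xy} is at most 1. Consequently Q_{xy} := ∑_{k=1}^{∞} (P^k)_{xy} ∈ [0,1] for all x, y, and Q_{xx} = 0. -/
open scoped BigOperators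

/-- Powers of a (possibly infinite) matrix `P : 𝔛 → 𝔛 → ℝ`, with
`(P^0) x y = δ_{xy}` and `(P^(k+1)) x y = ∑' z, (P^k) x z * P z y`. -/
noncomputable def powMat {𝔛 : Type*} [DecidableEq 𝔛] (P : 𝔛 → 𝔛 → ℝ) : ℕ → 𝔛 → 𝔛 → ℝ
  | 0 => fun x y => if x = y then 1 else 0
  | k + 1 => fun x y => ∑' z, powMat P k x z * P z y

/-- Powers of a matrix with extended nonnegative entries. -/
noncomputable def ennrealPowMat {𝔛 : Type*} [DecidableEq 𝔛] (Q : 𝔛 → 𝔛 → ENNReal) :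
    ℕ → 𝔛 → 𝔛 → ENNReal
  | 0 => fun x y => if x = y then 1 else 0
  | k + 1 => fun x y => ∑' z, ennrealPowMat Q k x z * Q z y

section

variable {𝔛 : Type*} [DecidableEq 𝔛]

theorem ennrealPowMat_succ' (Q : 𝔛 → 𝔛 → ENNReal) (k : ℕ) (x y : 𝔛) :
    ennrealPowMat Q (k + 1) x y = ∑' z, Q x z * ennrealPowMat Q k z y := by
  induction k generalizing y with
  | zero =>
    simp only [ennrealPowMat]
    rw [tsum_eq_single x (by intro z hz; simp [hz.symm]),
      tsum_eq_single y (by intro z hz; simp [hz])]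
    simp
  | succ k ih =>
    rw [ennrealPowMat]
    simp only [ih, ← ENNReal.tsum_mul_right]
    rw [ENNReal.tsum_comm]
    refine tsum_congr fun z => ?_
    rw [ennrealPowMat, ← ENNReal.tsum_mul_left]
    exact tsum_congr fun w => mul_assoc _ _ _

theorem ennrealPowMat_le_one {Q : 𝔛 → 𝔛 → ENNReal} (hQ : ∀ x, ∑' y, Q x y = 1)
    (k : ℕ) (x y : 𝔛) : ennrealPowMat Q k x y ≤ 1 := by
  induction k generalizing x with
  | zero => simp only [ennrealPowMat]; split_ifs <;> simp
  | succ k ih =>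
    rw [ennrealPowMat_succ', ← hQ x]
    exact ENNReal.tsum_le_tsum fun z => mul_le_of_le_one_right' (ih z)

theorem toReal_ennrealPowMat {P : 𝔛 → 𝔛 → ℝ} (hP : ∀ x y, 0 ≤ P x y)
    (hQ : ∀ x, ∑' y, ENNReal.ofReal (P x y) = 1) (k : ℕ) (x y : 𝔛) :
    (ennrealPowMat (fun x y => ENNReal.ofReal (P x y)) k x y).toReal = powMat P k x y := by
  induction k generalizing y with
  | zero => simp only [ennrealPowMat, powMat]; split_ifs <;> simp
  | succ k ih =>
    rw [ennrealPowMat, powMat, ENNReal.tsum_toReal_eq]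
    · simp [ih, hP]
    · exact fun z => ENNReal.mul_ne_top
        (ne_top_of_le_ne_top ENNReal.one_ne_top (ennrealPowMat_le_one hQ k x z))
        ENNReal.ofReal_ne_top

theorem sum_range_ennrealPowMat_le_one {Q : 𝔛 → 𝔛 → ENNReal} (hQ : ∀ x, ∑' y, Q x y = 1)
    (hloop : ∀ x k, ennrealPowMat Q (k + 1) x x = 0) (m : ℕ) (x y : 𝔛) :
    ∑ k ∈ Finset.range m, ennrealPowMat Q k x y ≤ 1 := by
  induction m generalizing x with
  | zero => simp
  | succ m ih =>
    rw [Finset.sum_range_succ']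
    by_cases hxy : x = y
    · subst hxy
      simp only [hloop, Finset.sum_const_zero, zero_add]
      simp [ennrealPowMat]
    · have h0 : ennrealPowMat Q 0 x y = 0 := by simp [ennrealPowMat, hxy]
      simp only [h0, add_zero, ennrealPowMat_succ']
      rw [← Summable.tsum_finsetSum fun _ _ => ENNReal.summable, ← hQ x]
      refine ENNReal.tsum_le_tsum fun z => ?_
      rw [← Finset.mul_sum]
      exact mul_le_of_le_one_right' (ih z)

end

/-- For a loop-free stochastic matrix `P` on a countable set, the partial sums
`∑_{k=1}^m (P^k) x y` are at most `1` for `x ≠ y`; consequently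
`Q x y = ∑_{k=1}^∞ (P^k) x y ∈ [0,1]` and `Q x x = 0`. -/
theorem loopFree_Q_mem_Icc {𝔛 : Type*} [Countable 𝔛] [DecidableEq 𝔛]
    (P : 𝔛 → 𝔛 → ℝ)
    (hP0 : ∀ x y, 0 ≤ P x y) (hP1 : ∀ x y, P x y ≤ 1)
    (hstoch : ∀ x, ∑' y, P x y = 1)
    (hloop : ∀ (x : 𝔛) (k : ℕ), 1 ≤ k → powMat P k x x = 0) :
    (∀ x y : 𝔛, x ≠ y → ∀ m : ℕ, 1 ≤ m →
        ∑ k ∈ Finset.Icc 1 m, powMat P k x y ≤ 1) ∧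
    (∀ x y : 𝔛, (∑' k : ℕ, powMat P (k + 1) x y) ∈ Set.Icc (0 : ℝ) 1) ∧
    (∀ x : 𝔛, (∑' k : ℕ, powMat P (k + 1) x x) = 0) := by
  have hQ : ∀ x, ∑' y, ENNReal.ofReal (P x y) = 1 := by
    intro x
    have hs : Summable (P x) := by
      by_contra h
      simpa [tsum_eq_zero_of_not_summable h] using hstoch x
    rw [← ENNReal.ofReal_tsum_of_nonneg (hP0 x) hs, hstoch, ENNReal.ofReal_one]
  have hE := toReal_ennrealPowMat hP0 hQ
  have hfin : ∀ k x y, ennrealPowMat (fun x y => ENNReal.ofReal (P x y)) k x y ≠ ⊤ :=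
    fun k x y => ne_top_of_le_ne_top ENNReal.one_ne_top (ennrealPowMat_le_one hQ k x y)
  have hEloop : ∀ x k, ennrealPowMat (fun x y => ENNReal.ofReal (P x y)) (k + 1) x x = 0 := by
    intro x k
    have h := hloop x (k + 1) (by omega)
    rw [← hE, ENNReal.toReal_eq_zero_iff] at h
    exact h.resolve_right (hfin _ _ _)
  have hnonneg : ∀ k x y, 0 ≤ powMat P k x y := fun k x y => by
    rw [← hE]
    exact ENNReal.toReal_nonneg
  have hpartial : ∀ m x y, ∑ k ∈ Finset.range m, powMat P (k + 1) x y ≤ 1 := by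
    intro m x y
    have hle : ∑ k ∈ Finset.range (m + 1), powMat P k x y ≤ 1 := by
      simp only [← hE]
      rw [← ENNReal.toReal_sum fun k _ => hfin k x y]
      exact ENNReal.toReal_mono ENNReal.one_ne_top
        (sum_range_ennrealPowMat_le_one hQ hEloop (m + 1) x y)
    rw [Finset.sum_range_succ'] at hle
    linarith [hnonneg 0 x y]
  refine ⟨fun x y _ m _ => ?_, fun x y => ⟨?_, ?_⟩, fun x => ?_⟩
  · rw [← Finset.Ico_add_one_right_eq_Icc, Finset.sum_Ico_eq_sum_range]
    simpa [add_comm] using hpartial m x y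
  · exact tsum_nonneg fun k => hnonneg _ _ _
  · exact Real.tsum_le_of_sum_range_le (fun k => hnonneg _ _ _) fun m => hpartial m x y
  · simp [hloop]
end

section
/- Let 𝔛 be a countable set and P : 𝔛 × 𝔛 → [0,1] a stochastic matrix (∑_y P_{xy} = 1 for all x) that is loop-free: (P^k)_{xx} = 0 for all x and all k ≥ 1. Let Q = ∑_{k≥1} P^k entrywise, let π be a probability distribution on 𝔛, and let (S_0, S_1, S_2, …) be the Markov chain with initial distribution π and transition matrix P, realized as a probability measure on 𝔛^ℕ (via the Ionescu–Tulcea construction). Define K_{xy} = π_x + (πQ)_x − Q_{yx}, where (πQ)_x = ∑_z π_z Q_{zx}. Then for any n ≥ 1 and any distinct points y_1, …, y_n ∈ 𝔛, the probability that {y_1, …, y_n} ⊆ {S_m : m ∈ ℕ} equals det[K_{y_i y_j}]_{i,j=1}^n. -/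
open scoped BigOperators
open MeasureTheory

/-- `Q x y = ∑_{k=1}^∞ (P^k) x y`. -/
noncomputable def Qmat {𝔛 : Type*} [DecidableEq 𝔛] (P : 𝔛 → 𝔛 → ℝ) (x y : 𝔛) : ℝ :=
  ∑' k : ℕ, powMat P (k + 1) x y

open scoped ENNReal

/-- The `k`-step transition probabilities of `P`, as extended nonnegative reals. -/
noncomputable def stepProb {𝔛 : Type*} [DecidableEq 𝔛] (P : 𝔛 → 𝔛 → ℝ) : ℕ → 𝔛 → 𝔛 → ℝ≥0∞
  | 0 => fun x y => if x = y then 1 else 0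
  | k + 1 => fun x y => ∑' z, stepProb P k x z * ENNReal.ofReal (P z y)

/-- The expected number of visits to `y` at positive times, starting from `x`. -/
noncomputable def greenProb {𝔛 : Type*} [DecidableEq 𝔛] (P : 𝔛 → 𝔛 → ℝ) (x y : 𝔛) : ℝ≥0∞ :=
  ∑' k : ℕ, stepProb P (k + 1) x y

/-- The trajectories that visit `y 0, …, y j` in this order, with `y j` visited at time `T`. -/
def orderedVisit {𝔛 : Type*} (y : ℕ → 𝔛) : ℕ → ℕ → Set (ℕ → 𝔛)
  | 0, T => {ω | ω T = y 0}
  | j + 1, T => {ω | ω T = y (j + 1) ∧ ∃ t < T, ω ∈ orderedVisit y j t}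

section Matrix

variable {𝔛 : Type*} [DecidableEq 𝔛] {P : 𝔛 → 𝔛 → ℝ}

lemma tsum_ofReal_eq_one {ι : Type*} {f : ι → ℝ} (h0 : ∀ i, 0 ≤ f i) (h1 : ∑' i, f i = 1) :
    ∑' i, ENNReal.ofReal (f i) = 1 := by
  have hs : Summable f := by
    by_contra h
    simp [tsum_eq_zero_of_not_summable h] at h1
  rw [← ENNReal.ofReal_tsum_of_nonneg h0 hs, h1, ENNReal.ofReal_one]

lemma tsum_stepProb (hP0 : ∀ x y, 0 ≤ P x y) (hstoch : ∀ x, ∑' y, P x y = 1) (k : ℕ) (x : 𝔛) :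
    ∑' y, stepProb P k x y = 1 := by
  induction k with
  | zero => simp [stepProb]
  | succ k ih =>
    simp only [stepProb]
    rw [ENNReal.tsum_comm]
    simp only [ENNReal.tsum_mul_left, tsum_ofReal_eq_one (hP0 _) (hstoch _), mul_one, ih]

lemma stepProb_ne_top (hP0 : ∀ x y, 0 ≤ P x y) (hstoch : ∀ x, ∑' y, P x y = 1) (k : ℕ)
    (x y : 𝔛) : stepProb P k x y ≠ ∞ :=
  ne_top_of_le_ne_top ENNReal.one_ne_top
    ((ENNReal.le_tsum y).trans_eq (tsum_stepProb hP0 hstoch k x))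

lemma powMat_eq_toReal_stepProb (hP0 : ∀ x y, 0 ≤ P x y) (hstoch : ∀ x, ∑' y, P x y = 1)
    (k : ℕ) (x y : 𝔛) : powMat P k x y = (stepProb P k x y).toReal := by
  induction k generalizing y with
  | zero => simp only [powMat, stepProb]; split_ifs <;> simp
  | succ k ih =>
    simp only [powMat, stepProb]
    rw [ENNReal.tsum_toReal_eq
      fun z => ENNReal.mul_ne_top (stepProb_ne_top hP0 hstoch k x z) ENNReal.ofReal_ne_top]
    exact tsum_congr fun z => by
      rw [ih, ENNReal.toReal_mul, ENNReal.toReal_ofReal (hP0 z y)]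

lemma Qmat_eq_toReal_greenProb (hP0 : ∀ x y, 0 ≤ P x y) (hstoch : ∀ x, ∑' y, P x y = 1)
    (x y : 𝔛) : Qmat P x y = (greenProb P x y).toReal := by
  rw [Qmat, greenProb, ENNReal.tsum_toReal_eq fun k => stepProb_ne_top hP0 hstoch (k + 1) x y]
  exact tsum_congr fun k => powMat_eq_toReal_stepProb hP0 hstoch (k + 1) x y

lemma stepProb_self_eq_zero (hP0 : ∀ x y, 0 ≤ P x y) (hstoch : ∀ x, ∑' y, P x y = 1)
    (hloop : ∀ (x : 𝔛) (k : ℕ), 1 ≤ k → powMat P k x x = 0) (k : ℕ) (x : 𝔛) :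
    stepProb P (k + 1) x x = 0 := by
  have h := hloop x (k + 1) (Nat.le_add_left 1 k)
  rw [powMat_eq_toReal_stepProb hP0 hstoch, ENNReal.toReal_eq_zero_iff] at h
  exact h.resolve_right (stepProb_ne_top hP0 hstoch _ x x)

lemma stepProb_succ_left (k : ℕ) (x y : 𝔛) :
    stepProb P (k + 1) x y = ∑' z, ENNReal.ofReal (P x z) * stepProb P k z y := by
  induction k generalizing y with
  | zero => simp [stepProb]
  | succ k ih =>
    rw [stepProb]
    simp only [ih, ← ENNReal.tsum_mul_right]
    rw [ENNReal.tsum_comm]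
    simp only [mul_assoc, ENNReal.tsum_mul_left, stepProb]

lemma sum_range_stepProb_le_one (hP0 : ∀ x y, 0 ≤ P x y) (hstoch : ∀ x, ∑' y, P x y = 1)
    (hloop : ∀ (x : 𝔛) (k : ℕ), 1 ≤ k → powMat P k x x = 0) (n : ℕ) (x y : 𝔛) :
    ∑ k ∈ Finset.range n, stepProb P k x y ≤ 1 := by
  induction n generalizing x with
  | zero => simp
  | succ n ih =>
    rw [Finset.sum_range_succ']
    by_cases hxy : x = y
    · subst hxy
      simp only [stepProb_self_eq_zero hP0 hstoch hloop]
      simp [stepProb]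
    · calc ∑ k ∈ Finset.range n, stepProb P (k + 1) x y + stepProb P 0 x y
          = ∑' z, ENNReal.ofReal (P x z) * ∑ k ∈ Finset.range n, stepProb P k z y := by
            simp only [stepProb_succ_left, Finset.mul_sum]
            rw [stepProb]
            simp only [if_neg hxy, add_zero]
            exact (Summable.tsum_finsetSum fun _ _ => ENNReal.summable).symm
        _ ≤ ∑' z, ENNReal.ofReal (P x z) :=
            ENNReal.tsum_le_tsum fun z => mul_le_of_le_one_right' (ih z)
        _ = 1 := tsum_ofReal_eq_one (hP0 x) (hstoch x)

lemma greenProb_le_one (hP0 : ∀ x y, 0 ≤ P x y) (hstoch : ∀ x, ∑' y, P x y = 1)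
    (hloop : ∀ (x : 𝔛) (k : ℕ), 1 ≤ k → powMat P k x x = 0) (x y : 𝔛) :
    greenProb P x y ≤ 1 := by
  refine le_trans ?_ (ENNReal.tsum_le_of_sum_range_le
    fun n => sum_range_stepProb_le_one hP0 hstoch hloop n x y)
  rw [tsum_eq_zero_add' ENNReal.summable]
  exact le_add_self

lemma stepProb_add_ne_zero {k l : ℕ} {x y z : 𝔛} (hxy : stepProb P k x y ≠ 0)
    (hyz : stepProb P l y z ≠ 0) : stepProb P (k + l) x z ≠ 0 := by
  induction l generalizing z with
  | zero =>
    have : y = z := by simpa [stepProb] using hyz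
    exact this ▸ hxy
  | succ l ih =>
    rw [stepProb, Ne, ENNReal.tsum_eq_zero, not_forall] at hyz
    obtain ⟨w, hw⟩ := hyz
    rw [← add_assoc, stepProb, Ne, ENNReal.tsum_eq_zero, not_forall]
    exact ⟨w, mul_ne_zero (ih (left_ne_zero_of_mul hw)) (right_ne_zero_of_mul hw)⟩

/-- Finitely many states can be listed so that no state leads to an earlier one or to itself. -/
lemma exists_perm_stepProb_eq_zero (hP0 : ∀ x y, 0 ≤ P x y) (hstoch : ∀ x, ∑' y, P x y = 1)
    (hloop : ∀ (x : 𝔛) (k : ℕ), 1 ≤ k → powMat P k x x = 0) {n : ℕ} (y : Fin n → 𝔛) :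
    ∃ σ : Equiv.Perm (Fin n), ∀ i j, i ≤ j → ∀ k, stepProb P (k + 1) (y (σ j)) (y (σ i)) = 0 := by
  classical
  let pred (i : Fin n) : Finset (Fin n) := {j | ∃ k, stepProb P (k + 1) (y j) (y i) ≠ 0}
  refine ⟨Tuple.sort fun i => (pred i).card, fun i j hij k => ?_⟩
  by_contra h
  refine (Tuple.monotone_sort (fun i => (pred i).card) hij).not_gt (Finset.card_lt_card ?_)
  rw [Finset.ssubset_iff_of_subset]
  · exact ⟨_, by simpa [pred] using ⟨k, h⟩,
      by simp [pred, stepProb_self_eq_zero hP0 hstoch hloop]⟩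
  · intro l hl
    obtain ⟨m, hm⟩ : ∃ m, stepProb P (m + 1) (y l) _ ≠ 0 := by simpa [pred] using hl
    have := stepProb_add_ne_zero hm h
    simpa [pred] using ⟨m + 1 + k, this⟩

/-- The determinant of a rank-one perturbation of a strictly triangular matrix. -/
lemma det_sub_strictTriangular {R : Type*} [CommRing R] {n : ℕ} (a : Fin (n + 1) → R)
    (q : Fin (n + 1) → Fin (n + 1) → R) (hq : ∀ i j, i ≤ j → q j i = 0) :
    (Matrix.of fun i j => a i - q j i).det = a 0 * ∏ i : Fin n, q i.castSucc i.succ := by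
  let B : Matrix (Fin (n + 1)) (Fin (n + 1)) R :=
    Matrix.of fun i => Fin.cons (a i - q 0 i) fun j : Fin n => q j.castSucc i - q j.succ i
  rw [Matrix.det_eq_of_forall_col_eq_smul_add_pred (B := B) (fun _ => 1) (by simp [B])
    (by intro i j; simp [B]), Matrix.det_succ_row_zero, Fin.sum_univ_succ,
    Finset.sum_eq_zero, Matrix.det_of_isLowerTriangular]
  · simp [B, hq]
  · intro i j hij
    have hij : i < j := hij
    simp [B, hq i.succ j.succ (Fin.succ_le_succ_iff.2 hij.le),
      hq i.succ j.castSucc (Fin.succ_le_castSucc_iff.2 hij)]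
  · intro j _
    simp [B, hq]

end Matrix

section Trajectories

variable {𝔛 : Type*}

lemma orderedVisit_subset (y : ℕ → 𝔛) (j T : ℕ) : orderedVisit y j T ⊆ {ω | ω T = y j} := by
  cases j with
  | zero => exact subset_rfl
  | succ j => exact fun _ h => h.1

lemma orderedVisit_congr {y : ℕ → 𝔛} {j T : ℕ} {ω ω' : ℕ → 𝔛} (h : ∀ i ≤ T, ω i = ω' i)
    (hω : ω ∈ orderedVisit y j T) : ω' ∈ orderedVisit y j T := by
  induction j generalizing T with
  | zero => exact (h T le_rfl).symm.trans hω
  | succ j ih =>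
    obtain ⟨hT, t, ht, hj⟩ := hω
    exact ⟨(h T le_rfl).symm.trans hT, t, ht, ih (fun i hi => h i (hi.trans ht.le)) hj⟩

lemma exists_eq_of_mem_orderedVisit {y : ℕ → 𝔛} {j T i : ℕ} {ω : ℕ → 𝔛}
    (hω : ω ∈ orderedVisit y j T) (hi : i ≤ j) : ∃ m, ω m = y i := by
  induction j generalizing T with
  | zero => exact ⟨T, Nat.le_zero.1 hi ▸ hω⟩
  | succ j ih =>
    obtain ⟨hT, t, -, hj⟩ := hω
    rcases hi.eq_or_lt with rfl | hi
    · exact ⟨T, hT⟩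
    · exact ih hj (Nat.lt_succ_iff.1 hi)

lemma mem_orderedVisit_of_increasing {y : ℕ → 𝔛} {ω : ℕ → 𝔛} {τ : ℕ → ℕ} {n : ℕ}
    (hτ : ∀ i ≤ n, ω (τ i) = y i) (hlt : ∀ i < n, τ i < τ (i + 1)) :
    ω ∈ orderedVisit y n (τ n) := by
  induction n with
  | zero => exact hτ 0 le_rfl
  | succ n ih =>
    exact ⟨hτ _ le_rfl, τ n, hlt n n.lt_succ_self,
      ih (fun i hi => hτ i (hi.trans n.le_succ)) fun i hi => hlt i (hi.trans n.lt_succ_self)⟩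

variable [MeasurableSpace 𝔛]

lemma measurableSet_eval_eq [MeasurableSingletonClass 𝔛] (T : ℕ) (x : 𝔛) :
    MeasurableSet {ω : ℕ → 𝔛 | ω T = x} := by
  have h : Measurable fun ω : ℕ → 𝔛 => ω T := measurable_pi_apply T
  exact h (measurableSet_singleton x)

lemma measurableSet_orderedVisit [MeasurableSingletonClass 𝔛] (y : ℕ → 𝔛) (j T : ℕ) :
    MeasurableSet (orderedVisit y j T) := by
  induction j generalizing T with
  | zero => exact measurableSet_eval_eq T _
  | succ j ih =>
    have : orderedVisit y (j + 1) T =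
        {ω | ω T = y (j + 1)} ∩ ⋃ t, ⋃ _ : t < T, orderedVisit y j t := by
      ext ω; simp [orderedVisit]
    rw [this]
    exact (measurableSet_eval_eq T _).inter
      (MeasurableSet.iUnion fun t => MeasurableSet.iUnion fun _ => ih t)

lemma measure_eq_tsum_inter_fiber {Ω ι : Type*} [MeasurableSpace Ω] [Countable ι]
    [MeasurableSpace ι] [MeasurableSingletonClass ι] (μ : Measure Ω) {f : Ω → ι}
    (hf : Measurable f) (s : Set Ω) : μ s = ∑' i, μ (s ∩ {ω | f ω = i}) := by
  have hm (i : ι) : MeasurableSet {ω | f ω = i} := hf (measurableSet_singleton i)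
  have h : ⋃ i, {ω | f ω = i} = Set.univ := by ext; simp
  rw [← Measure.restrict_apply_univ s, ← h, measure_iUnion _ hm]
  · exact tsum_congr fun i => by rw [Measure.restrict_apply (hm i), Set.inter_comm]
  · intro i j hij
    exact Set.disjoint_left.2 fun ω hi hj => hij (hi.symm.trans hj)

/-- `μ` has the finite-dimensional distributions of the Markov chain with initial distribution `π`
and transition matrix `P`. -/
def HasMarkovLaw (P : 𝔛 → 𝔛 → ℝ) (π : 𝔛 → ℝ) (μ : Measure (ℕ → 𝔛)) : Prop :=
  ∀ (n : ℕ) (x : ℕ → 𝔛), μ {ω | ∀ i ≤ n, ω i = x i} =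
    ENNReal.ofReal (π (x 0) * ∏ i ∈ Finset.range n, P (x i) (x (i + 1)))

namespace HasMarkovLaw

variable [Countable 𝔛] [MeasurableSingletonClass 𝔛] {P : 𝔛 → 𝔛 → ℝ} {π : 𝔛 → ℝ}
  {μ : Measure (ℕ → 𝔛)}

lemma measure_inter_next (hμ : HasMarkovLaw P π μ) (hP0 : ∀ x y, 0 ≤ P x y) {m : ℕ}
    {A : Set (ℕ → 𝔛)} (hA : ∀ ω ω' : ℕ → 𝔛, (∀ i ≤ m, ω i = ω' i) → ω ∈ A → ω' ∈ A) {x : 𝔛}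
    (hAx : A ⊆ {ω | ω m = x}) (y : 𝔛) :
    μ (A ∩ {ω | ω (m + 1) = y}) = μ A * ENNReal.ofReal (P x y) := by
  let r (ω : ℕ → 𝔛) (i : Fin (m + 1)) : 𝔛 := ω i
  have hr : Measurable r := measurable_pi_lambda _ fun i => measurable_pi_apply _
  rw [measure_eq_tsum_inter_fiber μ hr A, measure_eq_tsum_inter_fiber μ hr (A ∩ _),
    ← ENNReal.tsum_mul_right]
  refine tsum_congr fun v => ?_
  rw [Set.inter_right_comm]
  rcases (A ∩ {ω | r ω = v}).eq_empty_or_nonempty with h | ⟨ω₀, hω₀, rfl⟩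
  · simp [h]
  let u : ℕ → 𝔛 := Function.update ω₀ (m + 1) y
  have hu {i : ℕ} (hi : i ≤ m) : u i = ω₀ i := Function.update_of_ne (by lia) _ _
  have hu' : u (m + 1) = y := Function.update_self _ _ _
  have hcyl : A ∩ {ω | r ω = r ω₀} = {ω | ∀ i ≤ m, ω i = ω₀ i} := by
    ext ω
    constructor
    · exact fun h i hi => congrFun h.2 ⟨i, Nat.lt_succ_iff.2 hi⟩
    · exact fun h => ⟨hA _ _ (fun i hi => (h i hi).symm) hω₀,
        funext fun i => h i (Nat.lt_succ_iff.1 i.2)⟩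
  have hcyl' : A ∩ {ω | r ω = r ω₀} ∩ {ω | ω (m + 1) = y} = {ω | ∀ i ≤ m + 1, ω i = u i} := by
    ext ω
    rw [hcyl]
    constructor
    · rintro ⟨h, h'⟩ i hi
      rcases hi.eq_or_lt with rfl | hi
      · exact h'.trans hu'.symm
      · rw [hu (Nat.lt_succ_iff.1 hi), h i (Nat.lt_succ_iff.1 hi)]
    · exact fun h => ⟨fun i hi => (h i (by lia)).trans (hu hi), (h _ le_rfl).trans hu'⟩
  have hprod : ∏ i ∈ Finset.range m, P (u i) (u (i + 1)) =
      ∏ i ∈ Finset.range m, P (ω₀ i) (ω₀ (i + 1)) :=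
    Finset.prod_congr rfl fun i hi => by
      have := Finset.mem_range.1 hi
      rw [hu (by lia), hu (by lia)]
  have hx : ω₀ m = x := hAx hω₀
  rw [hcyl', hcyl, hμ, hμ, Finset.prod_range_succ, hprod, hu (Nat.zero_le m), hu le_rfl, hu', hx,
    ← mul_assoc, ENNReal.ofReal_mul' (hP0 x y)]

variable [DecidableEq 𝔛]

/-- The Markov property. -/
lemma measure_inter_add (hμ : HasMarkovLaw P π μ) (hP0 : ∀ x y, 0 ≤ P x y) {m : ℕ}
    {A : Set (ℕ → 𝔛)} (hA : ∀ ω ω' : ℕ → 𝔛, (∀ i ≤ m, ω i = ω' i) → ω ∈ A → ω' ∈ A) {x : 𝔛}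
    (hAx : A ⊆ {ω | ω m = x}) (k : ℕ) (y : 𝔛) :
    μ (A ∩ {ω | ω (m + k) = y}) = μ A * stepProb P k x y := by
  induction k generalizing y with
  | zero =>
    by_cases hxy : x = y
    · subst hxy
      simpa [stepProb] using congrArg μ (Set.inter_eq_left.2 hAx)
    · have : A ∩ {ω | ω m = y} = ∅ :=
        Set.eq_empty_of_forall_notMem fun ω h => hxy ((hAx h.1).symm.trans h.2)
      simp [stepProb, hxy, this]
  | succ k ih =>
    rw [measure_eq_tsum_inter_fiber μ (measurable_pi_apply (m + k)), stepProb,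
      ← ENNReal.tsum_mul_left]
    refine tsum_congr fun z => ?_
    rw [Set.inter_right_comm, ← mul_assoc, ← ih, ← add_assoc]
    refine hμ.measure_inter_next hP0 ?_ Set.inter_subset_right y
    refine fun ω ω' h hω => ⟨?_, ?_⟩
    · exact hA ω ω' (fun i hi => h i (by lia)) hω.1
    · exact (h _ le_rfl).symm.trans hω.2

lemma ae_stepProb_ne_zero (hμ : HasMarkovLaw P π μ) (hP0 : ∀ x y, 0 ≤ P x y) :
    ∀ᵐ ω ∂μ, ∀ s k, stepProb P (k + 1) (ω s) (ω (s + (k + 1))) ≠ 0 := by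
  have key (s k : ℕ) (x y : 𝔛) :
      ∀ᵐ ω ∂μ, ω s = x → ω (s + (k + 1)) = y → stepProb P (k + 1) x y ≠ 0 := by
    by_cases h : stepProb P (k + 1) x y = 0
    · have := hμ.measure_inter_add hP0 (A := {ω | ω s = x})
        (fun ω ω' h hω => (h s le_rfl).symm.trans hω) subset_rfl (k + 1) y
      rw [h, mul_zero] at this
      filter_upwards [measure_eq_zero_iff_ae_notMem.1 this] with ω hω hx hy
      exact absurd ⟨hx, hy⟩ hω
    · exact Filter.Eventually.of_forall fun _ _ _ => h
  filter_upwards [ae_all_iff.2 fun s => ae_all_iff.2 fun k => ae_all_iff.2 fun x =>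
    ae_all_iff.2 (key s k x)] with ω hω s k
  exact hω s k _ _ rfl rfl

lemma aedisjoint_eval_eq (hμ : HasMarkovLaw P π μ) (hP0 : ∀ x y, 0 ≤ P x y) {x : 𝔛}
    (hx : ∀ k, stepProb P (k + 1) x x = 0) {s t : ℕ} (hst : s ≠ t) :
    AEDisjoint μ {ω | ω s = x} {ω | ω t = x} := by
  wlog h : s < t generalizing s t
  · exact (this hst.symm (by lia)).symm
  obtain ⟨k, rfl⟩ := Nat.exists_eq_add_of_lt h
  refine measure_eq_zero_iff_ae_notMem.2 ?_
  filter_upwards [hμ.ae_stepProb_ne_zero hP0] with ω hω hmem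
  refine hω s k ?_
  rw [show ω s = x from hmem.1, show ω (s + (k + 1)) = x from hmem.2, hx]

lemma measure_orderedVisit_succ (hμ : HasMarkovLaw P π μ) (hP0 : ∀ x y, 0 ≤ P x y) {y : ℕ → 𝔛}
    {j : ℕ} (hy : ∀ k, stepProb P (k + 1) (y j) (y j) = 0) (T : ℕ) :
    μ (orderedVisit y (j + 1) T) = ∑' t, μ (orderedVisit y j t) *
      if t < T then stepProb P (T - t) (y j) (y (j + 1)) else 0 := by
  let S (t : ℕ) : Set (ℕ → 𝔛) := if t < T then orderedVisit y j t ∩ {ω | ω T = y (j + 1)} else ∅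
  have hS (t : ℕ) : S t ⊆ {ω | ω t = y j} := by
    by_cases h : t < T
    · simpa only [S, if_pos h] using Set.inter_subset_left.trans (orderedVisit_subset y j t)
    · simp [S, h]
  have hunion : orderedVisit y (j + 1) T = ⋃ t, S t := by
    ext ω
    simp only [orderedVisit, Set.mem_ofPred_eq, Set.mem_iUnion, S]
    constructor
    · rintro ⟨hT, t, ht, h⟩
      exact ⟨t, by rw [if_pos ht]; exact ⟨h, hT⟩⟩
    · rintro ⟨t, h⟩
      split_ifs at h with ht
      · exact ⟨h.2, t, ht, h.1⟩
      · exact h.elim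
  rw [hunion, measure_iUnion₀]
  · refine tsum_congr fun t => ?_
    by_cases h : t < T
    · obtain ⟨k, rfl⟩ := Nat.exists_eq_add_of_le h.le
      simp only [S, if_pos h, Nat.add_sub_cancel_left]
      exact hμ.measure_inter_add hP0 (fun _ _ => orderedVisit_congr) (orderedVisit_subset y j t) _ _
    · simp [S, h]
  · exact fun s t hst => (hμ.aedisjoint_eval_eq hP0 hy hst).mono (hS s) (hS t)
  · intro t
    refine MeasurableSet.nullMeasurableSet ?_
    by_cases h : t < T
    · simpa only [S, if_pos h] using
        (measurableSet_orderedVisit y j t).inter (measurableSet_eval_eq T _)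
    · simp [S, h]

lemma tsum_measure_orderedVisit_succ (hμ : HasMarkovLaw P π μ) (hP0 : ∀ x y, 0 ≤ P x y)
    {y : ℕ → 𝔛} {j : ℕ} (hy : ∀ k, stepProb P (k + 1) (y j) (y j) = 0) :
    ∑' T, μ (orderedVisit y (j + 1) T) =
      (∑' T, μ (orderedVisit y j T)) * greenProb P (y j) (y (j + 1)) := by
  simp only [hμ.measure_orderedVisit_succ hP0 hy]
  rw [ENNReal.tsum_comm, ← ENNReal.tsum_mul_right]
  refine tsum_congr fun t => ?_
  rw [ENNReal.tsum_mul_left, greenProb]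
  congr 1
  have hinj : Function.Injective fun k => t + (k + 1) := fun a b h => by simpa using h
  rw [← hinj.tsum_eq]
  · simp
  · intro T hT
    have : t < T := by by_contra h; simp [h] at hT
    exact ⟨T - t - 1, by simp only; lia⟩

lemma tsum_measure_orderedVisit (hμ : HasMarkovLaw P π μ) (hP0 : ∀ x y, 0 ≤ P x y)
    {y : ℕ → 𝔛} {n : ℕ} (hy : ∀ i < n, ∀ k, stepProb P (k + 1) (y i) (y i) = 0) :
    ∑' T, μ (orderedVisit y n T) = (∑' T, μ {ω | ω T = y 0}) *
      ∏ i ∈ Finset.range n, greenProb P (y i) (y (i + 1)) := by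
  induction n with
  | zero => simp [orderedVisit]
  | succ n ih =>
    rw [hμ.tsum_measure_orderedVisit_succ hP0 (hy n n.lt_succ_self),
      ih fun i hi => hy i (hi.trans n.lt_succ_self), Finset.prod_range_succ, mul_assoc]

lemma tsum_measure_eval_eq (hμ : HasMarkovLaw P π μ) (hP0 : ∀ x y, 0 ≤ P x y) (x : 𝔛) :
    ∑' T, μ {ω | ω T = x} =
      ENNReal.ofReal (π x) + ∑' z, ENNReal.ofReal (π z) * greenProb P z x := by
  have hinit (z : 𝔛) : μ {ω | ω 0 = z} = ENNReal.ofReal (π z) := by simpa using hμ 0 fun _ => z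
  have hT (T : ℕ) : μ {ω | ω T = x} = ∑' z, ENNReal.ofReal (π z) * stepProb P T z x := by
    rw [measure_eq_tsum_inter_fiber μ (measurable_pi_apply 0)]
    refine tsum_congr fun z => ?_
    have := hμ.measure_inter_add hP0 (A := {ω | ω 0 = z})
      (fun ω ω' h hω => (h 0 le_rfl).symm.trans hω) subset_rfl T x
    rwa [zero_add, hinit, Set.inter_comm] at this
  simp only [hT]
  rw [tsum_eq_zero_add' ENNReal.summable, ENNReal.tsum_comm]
  simp only [ENNReal.tsum_mul_left, greenProb]
  simp [stepProb]

/-- The probability of visiting all the points of a list, none of which leads to an earlier one. -/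
lemma measure_visit_all (hμ : HasMarkovLaw P π μ) (hP0 : ∀ x y, 0 ≤ P x y) {y : ℕ → 𝔛} {n : ℕ}
    (hne : ∀ i < n, y i ≠ y (i + 1))
    (hy : ∀ i ≤ n, ∀ k, stepProb P (k + 1) (y i) (y i) = 0)
    (hback : ∀ i < n, ∀ k, stepProb P (k + 1) (y (i + 1)) (y i) = 0) :
    μ {ω | ∀ i ≤ n, ∃ m, ω m = y i} = (∑' T, μ {ω | ω T = y 0}) *
      ∏ i ∈ Finset.range n, greenProb P (y i) (y (i + 1)) := by
  rw [← hμ.tsum_measure_orderedVisit hP0 fun i hi => hy i hi.le, ← measure_iUnion₀]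
  · refine measure_congr ?_
    filter_upwards [hμ.ae_stepProb_ne_zero hP0] with ω hω
    refine propext ⟨fun h => ?_, fun h i hi => ?_⟩
    · have h : ∀ i, ∃ m, i ≤ n → ω m = y i := fun i => by
        by_cases hi : i ≤ n
        · exact (h i hi).imp fun _ hm _ => hm
        · exact ⟨0, fun h => absurd h hi⟩
      choose τ hτ using h
      refine Set.mem_iUnion.2 ⟨τ n, mem_orderedVisit_of_increasing hτ fun i hi => ?_⟩
      rcases lt_trichotomy (τ i) (τ (i + 1)) with hlt | heq | hgt
      · exact hlt
      · exact absurd ((hτ i hi.le).symm.trans (heq ▸ hτ (i + 1) hi)) (hne i hi)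
      · obtain ⟨k, hk⟩ := Nat.exists_eq_add_of_lt hgt
        refine absurd (hback i hi k) ?_
        rw [← hτ i hi.le, ← hτ (i + 1) hi, hk]
        exact hω _ k
    · obtain ⟨T, hT⟩ := Set.mem_iUnion.1 h
      exact exists_eq_of_mem_orderedVisit hT hi
  · exact fun s t hst => (hμ.aedisjoint_eval_eq hP0 (hy n le_rfl) hst).mono
      (orderedVisit_subset y n s) (orderedVisit_subset y n t)
  · exact fun T => (measurableSet_orderedVisit y n T).nullMeasurableSet

end HasMarkovLaw

end Trajectories

/-- Theorem 1.1: for a loop-free Markov chain with initial distribution `π` and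
transition matrix `P`, realized as a probability measure `μ` on trajectories in
`ℕ → 𝔛` (characterized by its finite-dimensional distributions), the random set
of visited points is a determinantal point process with correlation kernel
`K x y = π x + (πQ) x - Q y x`. -/
theorem loopFree_markov_chain_determinantal {𝔛 : Type*} [Countable 𝔛] [DecidableEq 𝔛]
    [MeasurableSpace 𝔛] [MeasurableSingletonClass 𝔛]
    (P : 𝔛 → 𝔛 → ℝ) (π : 𝔛 → ℝ)
    (hP0 : ∀ x y, 0 ≤ P x y) (hP1 : ∀ x y, P x y ≤ 1)
    (hstoch : ∀ x, ∑' y, P x y = 1)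
    (hloop : ∀ (x : 𝔛) (k : ℕ), 1 ≤ k → powMat P k x x = 0)
    (hπ0 : ∀ x, 0 ≤ π x) (hπ1 : ∑' x, π x = 1)
    (μ : Measure (ℕ → 𝔛))
    (hμ : ∀ (n : ℕ) (x : ℕ → 𝔛),
      μ {ω | ∀ i ≤ n, ω i = x i} =
        ENNReal.ofReal (π (x 0) * ∏ i ∈ Finset.range n, P (x i) (x (i + 1))))
    (n : ℕ) (hn : 1 ≤ n) (y : Fin n → 𝔛) (hy : Function.Injective y) :
    μ {ω | ∀ i : Fin n, ∃ m : ℕ, ω m = y i} =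
      ENNReal.ofReal
        (Matrix.det (Matrix.of fun i j : Fin n =>
          π (y i) + (∑' z, π z * Qmat P z (y i)) - Qmat P (y j) (y i))) := by
  have hM : HasMarkovLaw P π μ := hμ
  obtain ⟨n, rfl⟩ := Nat.exists_eq_add_of_le' hn
  obtain ⟨σ, hσ⟩ := exists_perm_stepProb_eq_zero hP0 hstoch hloop y
  have hG (x z : 𝔛) : greenProb P x z ≠ ∞ :=
    ne_top_of_le_ne_top ENNReal.one_ne_top (greenProb_le_one hP0 hstoch hloop x z)
  have hGσ (i j : Fin (n + 1)) (hij : i ≤ j) : greenProb P (y (σ j)) (y (σ i)) = 0 :=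
    ENNReal.tsum_eq_zero.2 (hσ i j hij)
  have hsum (x : 𝔛) : ∑' z, ENNReal.ofReal (π z) * greenProb P z x ≠ ∞ := by
    refine ne_top_of_le_ne_top ENNReal.one_ne_top ?_
    rw [← tsum_ofReal_eq_one hπ0 hπ1]
    exact ENNReal.tsum_le_tsum fun z =>
      mul_le_of_le_one_right' (greenProb_le_one hP0 hstoch hloop z x)
  have hvisit (x : 𝔛) : π x + ∑' z, π z * Qmat P z x = (∑' T, μ {ω | ω T = x}).toReal := by
    rw [hM.tsum_measure_eval_eq hP0, ENNReal.toReal_add ENNReal.ofReal_ne_top (hsum x),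
      ENNReal.toReal_ofReal (hπ0 x),
      ENNReal.tsum_toReal_eq fun z => ENNReal.mul_ne_top ENNReal.ofReal_ne_top (hG z x)]
    simp only [ENNReal.toReal_mul, ENNReal.toReal_ofReal (hπ0 _),
      Qmat_eq_toReal_greenProb hP0 hstoch]
  have hvisit_ne_top (x : 𝔛) : ∑' T, μ {ω | ω T = x} ≠ ∞ := by
    rw [hM.tsum_measure_eval_eq hP0]
    exact ENNReal.add_ne_top.2 ⟨ENNReal.ofReal_ne_top, hsum x⟩
  have hdet : (Matrix.of fun i j : Fin (n + 1) =>
      π (y i) + (∑' z, π z * Qmat P z (y i)) - Qmat P (y j) (y i)).det =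
      ((∑' T, μ {ω | ω T = y (σ 0)}) *
        ∏ i : Fin n, greenProb P (y (σ i.castSucc)) (y (σ i.succ))).toReal := by
    rw [← Matrix.det_submatrix_equiv_self σ, ENNReal.toReal_mul, ENNReal.toReal_prod]
    simp only [hvisit]
    simp only [Qmat_eq_toReal_greenProb hP0 hstoch]
    exact det_sub_strictTriangular (fun i => (∑' T, μ {ω | ω T = y (σ i)}).toReal)
      (fun i j => (greenProb P (y (σ i)) (y (σ j))).toReal) fun i j hij => by
        rw [hGσ i j hij, ENNReal.toReal_zero]
  rw [hdet, ENNReal.ofReal_toReal (ENNReal.mul_ne_top (hvisit_ne_top _)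
    (ENNReal.prod_ne_top fun i _ => hG _ _))]
  let y' (i : ℕ) : 𝔛 := y (σ (Fin.ofNat (n + 1) i))
  have hy' (i : Fin (n + 1)) : y' i = y (σ i) := by simp [y']
  have hval {i : ℕ} (hi : i ≤ n) : y' i = y (σ ⟨i, Nat.lt_succ_iff.2 hi⟩) := hy' ⟨i, _⟩
  have hset : {ω : ℕ → 𝔛 | ∀ i, ∃ m, ω m = y i} = {ω | ∀ i ≤ n, ∃ m, ω m = y' i} := by
    ext ω
    constructor
    · exact fun h i _ => h _
    · intro h i
      have := h (σ.symm i) (Nat.lt_succ_iff.1 (σ.symm i).2)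
      rwa [hy', σ.apply_symm_apply] at this
  rw [hset, hM.measure_visit_all hP0, Finset.prod_range]
  · congr 1
    exact Finset.prod_congr rfl fun i _ => congrArg₂ _ (hy' i.castSucc) (hy' i.succ)
  · intro i hi
    rw [hval hi.le, hval hi]
    exact (hy.comp σ.injective).ne (by simp)
  · intro i hi
    rw [hval hi]
    exact hσ _ _ le_rfl
  · intro i hi
    rw [hval hi.le, hval hi]
    exact hσ _ _ (by simp)
end

section
/- In the setting of Theorem 1.3 (countable 𝔛, loop-free stochastic P, initial distribution π, finite no-return window 𝔜 with π_0 ≠ 0, π̃_y the probability that the trajectory's first point in 𝔜 is y, P_{y𝓕} = 1 − ∑_{y'∈𝔜} P_{yy'}), define the matrix L on 𝔜 × 𝔜 by L_{xy} = π̃_x P_{y𝓕}/π_0 − P_{yx}. Then for every subset Y = {y_1, …, y_m} ⊆ 𝔜, det(L|_{Y×Y}) = π_0^{-1} · Prob{the intersection of the trajectory with 𝔜 equals exactly Y}; in particular, det(1 + L) = π_0^{-1}. -/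
open scoped BigOperators
open MeasureTheory

section PowMat

lemma summable_row {𝔛 : Type*} {P : 𝔛 → 𝔛 → ℝ} (hstoch : ∀ x, ∑' y, P x y = 1)
    (x : 𝔛) : Summable (P x) := by
  by_contra h
  simpa [tsum_eq_zero_of_not_summable h] using hstoch x

lemma entry_le_one {𝔛 : Type*} {P : 𝔛 → 𝔛 → ℝ}
    (hP0 : ∀ x y, 0 ≤ P x y) (hstoch : ∀ x, ∑' y, P x y = 1)
    (x y : 𝔛) : P x y ≤ 1 :=
  hstoch x ▸ (summable_row hstoch x).le_tsum y fun j _ => hP0 x j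

variable {𝔛 : Type*} [DecidableEq 𝔛] {P : 𝔛 → 𝔛 → ℝ}

lemma powMat_nonneg (hP0 : ∀ x y, 0 ≤ P x y) (k : ℕ) (x y : 𝔛) : 0 ≤ powMat P k x y := by
  induction k generalizing y with
  | zero => simp only [powMat]; split_ifs <;> norm_num
  | succ k ih => exact tsum_nonneg fun z => mul_nonneg (ih z) (hP0 z y)

/-- Powers of a stochastic matrix are substochastic. -/
lemma summable_powMat_and_tsum_le_one (hP0 : ∀ x y, 0 ≤ P x y)
    (hstoch : ∀ x, ∑' y, P x y = 1) (k : ℕ) (x : 𝔛) :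
    Summable (powMat P k x) ∧ ∑' y, powMat P k x y ≤ 1 := by
  induction k with
  | zero =>
    have h0 (y : 𝔛) (hy : y ≠ x) : powMat P 0 x y = 0 := by simp [powMat, hy.symm]
    refine ⟨summable_of_ne_finset_zero (s := {x}) fun y hy => h0 y (by simpa using hy), ?_⟩
    rw [tsum_eq_single x h0]
    simp [powMat]
  | succ k ih =>
    have hs (y : 𝔛) : Summable fun z => powMat P k x z * P z y :=
      ih.1.of_nonneg_of_le (fun z => mul_nonneg (powMat_nonneg hP0 k x z) (hP0 z y))
        fun z => mul_le_of_le_one_right (powMat_nonneg hP0 k x z) (entry_le_one hP0 hstoch z y)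
    have hF (F : Finset 𝔛) : ∑ y ∈ F, powMat P (k + 1) x y ≤ 1 := by
      simp only [powMat]
      rw [← Summable.tsum_finsetSum fun y _ => hs y]
      refine (Summable.tsum_le_tsum (fun z => ?_) (summable_sum fun y _ => hs y) ih.1).trans ih.2
      rw [← Finset.mul_sum]
      refine mul_le_of_le_one_right (powMat_nonneg hP0 k x z) ?_
      exact hstoch z ▸ (summable_row hstoch z).sum_le_tsum F fun y _ => hP0 z y
    exact ⟨summable_of_sum_le (fun y => powMat_nonneg hP0 (k + 1) x y) hF,
      Real.tsum_le_of_sum_le (fun y => powMat_nonneg hP0 (k + 1) x y) hF⟩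

lemma powMat_le_one (hP0 : ∀ x y, 0 ≤ P x y) (hstoch : ∀ x, ∑' y, P x y = 1)
    (k : ℕ) (x y : 𝔛) : powMat P k x y ≤ 1 :=
  ((summable_powMat_and_tsum_le_one hP0 hstoch k x).1.le_tsum y
    fun z _ => powMat_nonneg hP0 k x z).trans (summable_powMat_and_tsum_le_one hP0 hstoch k x).2

lemma summable_powMat_mul (hP0 : ∀ x y, 0 ≤ P x y) (hstoch : ∀ x, ∑' y, P x y = 1)
    (k : ℕ) (x y : 𝔛) : Summable fun z => powMat P k x z * P z y :=
  (summable_powMat_and_tsum_le_one hP0 hstoch k x).1.of_nonneg_of_le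
    (fun z => mul_nonneg (powMat_nonneg hP0 k x z) (hP0 z y))
    fun z => mul_le_of_le_one_right (powMat_nonneg hP0 k x z) (entry_le_one hP0 hstoch z y)

lemma powMat_one (x y : 𝔛) : powMat P 1 x y = P x y := by
  simp only [powMat]
  rw [tsum_eq_single x fun z hz => by simp [Ne.symm hz]]
  simp

/-- The first-step recursion for matrix powers. -/
lemma powMat_succ' (hP0 : ∀ x y, 0 ≤ P x y) (hstoch : ∀ x, ∑' y, P x y = 1)
    (k : ℕ) (x y : 𝔛) :
    Summable (fun z => P x z * powMat P k z y) ∧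
      powMat P (k + 1) x y = ∑' z, P x z * powMat P k z y := by
  induction k generalizing y with
  | zero =>
    have h0 (z : 𝔛) (hz : z ≠ y) : P x z * powMat P 0 z y = 0 := by simp [powMat, hz]
    refine ⟨summable_of_ne_finset_zero (s := {y}) fun z hz => h0 z (by simpa using hz), ?_⟩
    rw [tsum_eq_single y h0, powMat_one]
    simp [powMat]
  | succ k ih =>
    have hnn (w z : 𝔛) : 0 ≤ P x w * powMat P k w z * P z y :=
      mul_nonneg (mul_nonneg (hP0 _ _) (powMat_nonneg hP0 _ _ _)) (hP0 _ _)
    have hinner (w : 𝔛) :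
        ∑' z, P x w * powMat P k w z * P z y = P x w * powMat P (k + 1) w y := by
      simp only [mul_assoc, tsum_mul_left, powMat]
    have hs : Summable fun w => P x w * powMat P (k + 1) w y :=
      (summable_row hstoch x).of_nonneg_of_le
        (fun w => mul_nonneg (hP0 _ _) (powMat_nonneg hP0 _ _ _))
        fun w => mul_le_of_le_one_right (hP0 _ _) (powMat_le_one hP0 hstoch (k + 1) w y)
    refine ⟨hs, ?_⟩
    have huncurry : Summable (Function.uncurry fun w z => P x w * powMat P k w z * P z y) := by
      refine (summable_prod_of_nonneg fun p => hnn p.1 p.2).2 ⟨fun w => ?_, ?_⟩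
      · simp only [mul_assoc]
        exact (summable_powMat_mul hP0 hstoch k w y).mul_left _
      · simpa only [Function.uncurry_apply_pair, hinner] using hs
    rw [← tsum_congr hinner, ← huncurry.tsum_comm]
    rw [powMat]
    exact tsum_congr fun z => by rw [(ih z).2, tsum_mul_right]

/-- For a loop-free chain the expected number of visits to a state is at most one. -/
lemma sum_powMat_le_one (hP0 : ∀ x y, 0 ≤ P x y) (hstoch : ∀ x, ∑' y, P x y = 1)
    (hloop : ∀ (x : 𝔛) (k : ℕ), 1 ≤ k → powMat P k x x = 0) (n : ℕ) (x y : 𝔛) :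
    ∑ k ∈ Finset.range n, powMat P k x y ≤ 1 := by
  induction n generalizing x with
  | zero => simp
  | succ n ih =>
    rw [Finset.sum_range_succ']
    by_cases hxy : x = y
    · subst hxy
      rw [Finset.sum_eq_zero fun k _ => hloop x (k + 1) (by omega)]
      simp [powMat]
    · simp only [fun k => (powMat_succ' hP0 hstoch k x y).2]
      rw [← Summable.tsum_finsetSum fun k _ => (powMat_succ' hP0 hstoch k x y).1]
      simp only [powMat, if_neg hxy, add_zero, ← Finset.mul_sum]
      rw [← hstoch x]
      have hle (z : 𝔛) : P x z * ∑ k ∈ Finset.range n, powMat P k z y ≤ P x z :=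
        mul_le_of_le_one_right (hP0 _ _) (ih z)
      exact Summable.tsum_le_tsum hle ((summable_row hstoch x).of_nonneg_of_le
        (fun z => mul_nonneg (hP0 _ _) (Finset.sum_nonneg fun k _ => powMat_nonneg hP0 _ _ _))
        hle) (summable_row hstoch x)

lemma exists_powMat_pos_of_transGen (hP0 : ∀ x y, 0 ≤ P x y) (hstoch : ∀ x, ∑' y, P x y = 1)
    {x y : 𝔛} (h : Relation.TransGen (fun x y => 0 < P x y) x y) :
    ∃ k, 0 < powMat P (k + 1) x y := by
  induction h with
  | single h => exact ⟨0, by rwa [powMat_one]⟩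
  | @tail b c _ hbc ih =>
    obtain ⟨k, hk⟩ := ih
    refine ⟨k + 1, (mul_pos hk hbc).trans_le ?_⟩
    exact (summable_powMat_mul hP0 hstoch (k + 1) x c).le_tsum b
      fun z _ => mul_nonneg (powMat_nonneg hP0 _ _ _) (hP0 _ _)

lemma Qmat_pos_of_transGen (hP0 : ∀ x y, 0 ≤ P x y) (hstoch : ∀ x, ∑' y, P x y = 1)
    (hloop : ∀ (x : 𝔛) (k : ℕ), 1 ≤ k → powMat P k x x = 0)
    {x y : 𝔛} (h : Relation.TransGen (fun x y => 0 < P x y) x y) : 0 < Qmat P x y := by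
  obtain ⟨k, hk⟩ := exists_powMat_pos_of_transGen hP0 hstoch h
  have hs : Summable fun k => powMat P k x y :=
    summable_of_sum_range_le (fun k => powMat_nonneg hP0 k x y)
      fun n => sum_powMat_le_one hP0 hstoch hloop n x y
  exact hk.trans_le (((summable_nat_add_iff 1).2 hs).le_tsum k
    fun j _ => powMat_nonneg hP0 _ _ _)

lemma not_transGen_self (hP0 : ∀ x y, 0 ≤ P x y) (hstoch : ∀ x, ∑' y, P x y = 1)
    (hloop : ∀ (x : 𝔛) (k : ℕ), 1 ≤ k → powMat P k x x = 0) (x : 𝔛) :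
    ¬ Relation.TransGen (fun x y => 0 < P x y) x x := fun h => by
  obtain ⟨k, hk⟩ := exists_powMat_pos_of_transGen hP0 hstoch h
  exact hk.ne' (hloop x (k + 1) (by omega))

end PowMat

section LinearAlgebra

/-- The determinant of a rank one matrix minus a strictly lower triangular one. -/
lemma det_mul_sub_of_strictly_triangular {R : Type*} [Field R] {m : ℕ}
    (u v : Fin (m + 1) → R) (p : Fin (m + 1) → Fin (m + 1) → R)
    (hp : ∀ i j, j ≤ i → p i j = 0) :
    Matrix.det (Matrix.of fun i j => u i * v j - p j i) =
      u 0 * v (Fin.last m) * ∏ i : Fin m, p i.castSucc i.succ := by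
  by_cases hu : u 0 = 0
  · rw [hu, zero_mul, zero_mul]
    exact Matrix.det_eq_zero_of_row_eq_zero 0 fun j => by simp [hu, hp j 0 (Fin.zero_le j)]
  set B : Matrix (Fin (m + 1)) (Fin (m + 1)) R :=
    Matrix.of fun i j => if i = 0 then u 0 * v j else - p j i with hB
  have hdet : Matrix.det (Matrix.of fun i j => u i * v j - p j i) = B.det := by
    refine Matrix.det_eq_of_forall_row_eq_smul_add_const
      (fun i => if i = 0 then 0 else u i / u 0) 0 (by simp) fun i j => ?_
    by_cases hi : i = 0
    · subst hi
      simp [hB, hp j 0 (Fin.zero_le j)]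
    · simp only [hB, Matrix.of_apply, if_neg hi, if_true]
      field_simp
      ring
  have hrot := Matrix.det_permute (finRotate (m + 1)) B
  have hlt (i : Fin m) : finRotate (m + 1) i.castSucc = i.succ := finRotate_of_lt i.2
  have htri : (B.submatrix (finRotate (m + 1)) id).IsLowerTriangular := by
    intro i j hij
    have hij : i < j := hij
    obtain ⟨i, rfl⟩ := Fin.exists_castSucc_eq.2 (ne_of_lt (hij.trans_le (Fin.le_last j)))
    simp only [Matrix.submatrix_apply, hlt, hB, Matrix.of_apply, id, Fin.succ_ne_zero, if_false]
    rw [hp j i.succ (Fin.castSucc_lt_iff_succ_le.1 hij), neg_zero]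
  rw [Matrix.det_of_isLowerTriangular _ htri, sign_finRotate, Fin.prod_univ_castSucc] at hrot
  simp only [Matrix.submatrix_apply, hlt, finRotate_last, hB, Matrix.of_apply, id,
    Fin.succ_ne_zero, if_false, if_true, Finset.prod_neg, Finset.card_univ, Fintype.card_fin,
    Nat.add_sub_cancel, Units.val_pow_eq_pow_val, Units.val_neg, Units.val_one, Int.cast_pow,
    Int.cast_neg, Int.cast_one, mul_assoc] at hrot
  rw [hdet, ← mul_left_cancel₀ (pow_ne_zero m (neg_ne_zero.2 one_ne_zero)) hrot]
  ring

/-- A finite set can be enumerated compatibly with a strict order. -/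
lemma exists_enumeration {α : Type*} (r : α → α → Prop) [IsTrans α r] (hirr : ∀ x, ¬ r x x)
    (s : Finset α) {k : ℕ} (hk : s.card = k) :
    ∃ e : Fin k ≃ s, ∀ i j, r (e i) (e j) → i < j := by
  have hpo : IsPartialOrder α (fun x y => x = y ∨ r x y) :=
    { refl := fun x => Or.inl rfl
      trans := by
        rintro x y z (rfl | h) (rfl | h')
        · exact Or.inl rfl
        · exact Or.inr h'
        · exact Or.inr h
        · exact Or.inr (_root_.trans h h')
      antisymm := by
        rintro x y (rfl | h) (h' | h')
        · rfl
        · rfl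
        · exact h'.symm
        · exact absurd (_root_.trans h h') (hirr x) }
  obtain ⟨t, ht, hle⟩ := extend_partialOrder (fun x y => x = y ∨ r x y)
  classical
  let _ : LinearOrder α :=
    { le := t
      le_refl := ht.refl
      le_trans := ht.trans
      le_antisymm := ht.antisymm
      le_total := ht.total
      toDecidableLE := Classical.decRel _ }
  refine ⟨(s.orderIsoOfFin hk).toEquiv, fun i j hij => ?_⟩
  have hne : i ≠ j := fun h => hirr _ (h ▸ hij)
  have : ((s.orderIsoOfFin hk i : s) : α) ≤ s.orderIsoOfFin hk j := hle _ _ (Or.inr hij)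
  exact lt_of_le_of_ne ((s.orderIsoOfFin hk).le_iff_le.1 this) hne

/-- Multiplying a perturbation of the identity by `1 - Aᵀ` with `A` strictly triangular. -/
lemma det_one_add_of_strictly_triangular {R ι : Type*} [Field R] [Fintype ι] [DecidableEq ι]
    {k : ℕ} (e : Fin k ≃ ι) (u v : ι → R) (p : ι → ι → R)
    (hp : ∀ i j, j ≤ i → p (e i) (e j) = 0) (hv : ∀ y, v y = 1 - ∑ z, p y z) :
    Matrix.det (1 + Matrix.of fun x y => u x * v y - p y x) = 1 + ∑ x, u x := by
  have hfac : (1 + Matrix.of fun x y => u x * v y - p y x : Matrix ι ι R) =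
      (1 + (Matrix.replicateCol Unit u * Matrix.replicateRow Unit (fun _ => (1 : R)) : Matrix ι ι R)) *
        (1 - Matrix.of fun x y => p y x) := by
    rw [add_mul, one_mul, mul_sub, mul_one]
    ext x y
    simp [mul_sub, hv, Matrix.mul_apply, Finset.mul_sum]
    ring
  have hone : Matrix.det (1 - Matrix.of fun x y => p y x : Matrix ι ι R) = 1 := by
    rw [← Matrix.det_submatrix_equiv_self e, Matrix.det_of_isLowerTriangular]
    · simp [hp]
    · intro i j hij
      have hij : i < j := hij
      simp [hij.ne, hp j i hij.le]
  rw [hfac, Matrix.det_mul, hone, Matrix.det_one_add_replicateCol_mul_replicateRow]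
  simp [dotProduct]

end LinearAlgebra

section Trajectory

/-- A trajectory that moves along a strict order and does not return to `𝔜` meets `𝔜` exactly in
`Y` iff it runs through the increasing enumeration of `Y` in consecutive steps. -/
lemma trajectory_inter_eq_iff {α : Type*} {r : α → α → Prop} (hirr : ∀ x, ¬ r x x)
    {ω : ℕ → α} (hω : ∀ i j, i < j → r (ω i) (ω j)) {𝔜 Y : Finset α} (hY : Y ⊆ 𝔜)
    (hno : ∀ y ∈ 𝔜, ∀ z ∉ 𝔜, r y z → ∀ y' ∈ 𝔜, ¬ r z y') {m : ℕ} {f : ℕ → α}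
    (hfY : ∀ i ≤ m, f i ∈ Y) (hfsurj : ∀ x ∈ Y, ∃ i ≤ m, f i = x)
    (hfinj : ∀ i ≤ m, ∀ j ≤ m, f i = f j → i = j)
    (hfr : ∀ i ≤ m, ∀ j ≤ m, r (f i) (f j) → i < j) :
    (∀ x ∈ 𝔜, (x ∈ Y ↔ ∃ k, ω k = x)) ↔
      ∃ n, ((∀ k < n, ω k ∉ 𝔜) ∧ ω n = f 0) ∧ (∀ i ≤ m, ω (n + i) = f i) ∧
        ω (n + m + 1) ∉ 𝔜 := by
  have hconv {i j k : ℕ} (hij : i < j) (hjk : j < k) (hi : ω i ∈ 𝔜) (hk : ω k ∈ 𝔜) :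
      ω j ∈ 𝔜 := by
    by_contra hj
    exact hno _ hi _ hj (hω _ _ hij) _ hk (hω _ _ hjk)
  constructor
  · intro h
    have hex (i : ℕ) : ∃ k, i ≤ m → ω k = f i := by
      by_cases hi : i ≤ m
      · obtain ⟨k, hk⟩ := (h _ (hY (hfY i hi))).1 (hfY i hi)
        exact ⟨k, fun _ => hk⟩
      · exact ⟨0, fun h => absurd h hi⟩
    choose t ht using hex
    have hmono {i j : ℕ} (hij : i < j) (hj : j ≤ m) : t i < t j := by
      rcases lt_trichotomy (t i) (t j) with h1 | h1 | h1
      · exact h1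
      · have := hfinj i (by omega) j hj (by rw [← ht i (by omega), ← ht j hj, h1])
        omega
      · have := hω _ _ h1
        rw [ht i (by omega), ht j hj] at this
        have := hfr j hj i (by omega) this
        omega
    have hvis {k : ℕ} (hk : ω k ∈ 𝔜) : ∃ i ≤ m, k = t i := by
      obtain ⟨i, hi, hik⟩ := hfsurj _ ((h _ hk).2 ⟨k, rfl⟩)
      refine ⟨i, hi, ?_⟩
      by_contra hne
      have heq : ω k = ω (t i) := by rw [ht i hi, hik]
      rcases Ne.lt_or_gt hne with h1 | h1
      · exact hirr _ (heq ▸ hω _ _ h1)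
      · exact hirr _ (heq ▸ hω _ _ h1)
    have hmem {i : ℕ} (hi : i ≤ m) : ω (t i) ∈ 𝔜 := ht i hi ▸ hY (hfY i hi)
    have hmono' {i j : ℕ} (hi : i ≤ m) (hij : t i < t j) : i < j := by
      by_contra hji
      rcases (not_lt.1 hji).lt_or_eq with h1 | h1
      · have := hmono h1 hi
        omega
      · subst h1
        omega
    have hstep (i : ℕ) (hi : i ≤ m) : t i = t 0 + i := by
      induction i with
      | zero => rfl
      | succ i ih =>
        have h1 : t i < t (i + 1) := hmono (Nat.lt_succ_self i) hi
        have h2 := ih (by omega)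
        by_contra hne
        obtain ⟨l, hl, hlt⟩ := hvis (hconv (Nat.lt_succ_self (t i)) (by omega : t i + 1 < t (i + 1))
          (hmem (by omega)) (hmem hi))
        have h3 := hmono' (by omega) (by omega : t i < t l)
        have h4 := hmono' hl (by omega : t l < t (i + 1))
        omega
    refine ⟨t 0, ⟨fun k hk hmk => ?_, ht 0 (Nat.zero_le m)⟩, fun i hi => ?_, fun hmk => ?_⟩
    · obtain ⟨i, hi, rfl⟩ := hvis hmk
      rw [hstep i hi] at hk
      omega
    · rw [← hstep i hi, ht i hi]
    · obtain ⟨i, hi, hik⟩ := hvis hmk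
      rw [hstep i hi] at hik
      omega
  · rintro ⟨n, ⟨hbefore, -⟩, hrun, hafter⟩ x hx
    constructor
    · intro hxY
      obtain ⟨i, hi, rfl⟩ := hfsurj x hxY
      exact ⟨n + i, hrun i hi⟩
    · rintro ⟨k, rfl⟩
      have h1 : n ≤ k := by
        by_contra hlt
        exact hbefore k (by omega) hx
      obtain ⟨i, rfl⟩ := Nat.exists_eq_add_of_le h1
      by_cases hi : i ≤ m
      · exact hrun i hi ▸ hfY i hi
      · have hm : ω (n + m) ∈ 𝔜 := hrun m le_rfl ▸ hY (hfY m le_rfl)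
        by_cases hi' : i = m + 1
        · subst hi'
          exact absurd hx hafter
        · exact absurd (hconv (Nat.lt_succ_self _) (by omega) hm hx) hafter

end Trajectory

section MarkovChain

variable {𝔛 : Type*} [Countable 𝔛] [MeasurableSpace 𝔛] [MeasurableSingletonClass 𝔛]
  {P : 𝔛 → 𝔛 → ℝ} {π : 𝔛 → ℝ} {μ : Measure (ℕ → 𝔛)}

lemma measurableSet_coord_mem (k : ℕ) (B : Set 𝔛) : MeasurableSet {ω : ℕ → 𝔛 | ω k ∈ B} :=
  measurable_pi_apply k B.to_countable.measurableSet

/-- The one-step Markov property. -/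
lemma measure_inter_next_eq (hP0 : ∀ x y, 0 ≤ P x y) (hπ0 : ∀ x, 0 ≤ π x)
    (hμ : ∀ (n : ℕ) (x : ℕ → 𝔛),
      μ {ω | ∀ i ≤ n, ω i = x i} =
        ENNReal.ofReal (π (x 0) * ∏ i ∈ Finset.range n, P (x i) (x (i + 1))))
    {n : ℕ} {S : Set (ℕ → 𝔛)} {x : 𝔛}
    (hS : ∀ ω ω', (∀ i ≤ n, ω i = ω' i) → ω ∈ S → ω' ∈ S) (hx : ∀ ω ∈ S, ω n = x) (y : 𝔛) :
    μ (S ∩ {ω | ω (n + 1) = y}) = μ S * ENNReal.ofReal (P x y) := by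
  set f : (ℕ → 𝔛) → Fin (n + 1) → 𝔛 := fun ω i => ω i with hf
  have hfm : Measurable f := by fun_prop
  have hSf : S = f ⁻¹' (f '' S) := by
    refine (Set.subset_preimage_image f S).antisymm ?_
    rintro ω ⟨ω', hω', h⟩
    exact hS ω' ω (fun i hi => congrFun h ⟨i, by omega⟩) hω'
  have hB : MeasurableSet {ω : ℕ → 𝔛 | ω (n + 1) = y} :=
    measurableSet_coord_mem (n + 1) {y}
  rw [hSf, ← Measure.restrict_apply' hB,
    ← tsum_measure_preimage_singleton (f '' S).to_countable
      fun b _ => hfm (measurableSet_singleton b),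
    ← tsum_measure_preimage_singleton (f '' S).to_countable
      fun b _ => hfm (measurableSet_singleton b), ← ENNReal.tsum_mul_right]
  refine tsum_congr fun b => ?_
  obtain ⟨_, ω₀, hω₀, rfl⟩ := b
  rw [Measure.restrict_apply' hB]
  set ω₁ : ℕ → 𝔛 := fun i => if i ≤ n then ω₀ i else y with hω₁
  have h1 (i : ℕ) (hi : i ≤ n) : ω₁ i = ω₀ i := if_pos hi
  have h2 : ω₁ (n + 1) = y := if_neg (by omega)
  have e1 : f ⁻¹' {f ω₀} = {ω | ∀ i ≤ n, ω i = ω₁ i} := by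
    ext ω
    simp only [Set.mem_preimage, Set.mem_singleton_iff, Set.mem_ofPred_eq]
    constructor
    · intro h i hi
      rw [h1 i hi]
      exact congrFun h ⟨i, by omega⟩
    · intro h
      funext i
      exact (h i (by omega)).trans (h1 i (by omega))
  have e2 : f ⁻¹' {f ω₀} ∩ {ω | ω (n + 1) = y} = {ω | ∀ i ≤ n + 1, ω i = ω₁ i} := by
    rw [e1]
    ext ω
    simp only [Set.mem_inter_iff, Set.mem_ofPred_eq, Nat.le_succ_iff, or_imp, forall_and,
      forall_eq, h2]
  rw [e2, e1, hμ, hμ, Finset.prod_range_succ, ← mul_assoc, h1 n le_rfl, h2, hx _ hω₀,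
    ENNReal.ofReal_mul]
  exact mul_nonneg (hπ0 _) (Finset.prod_nonneg fun i _ => hP0 _ _)

/-- The Markov property along a finite run of states. -/
lemma measure_inter_run_eq (hP0 : ∀ x y, 0 ≤ P x y) (hπ0 : ∀ x, 0 ≤ π x)
    (hμ : ∀ (n : ℕ) (x : ℕ → 𝔛),
      μ {ω | ∀ i ≤ n, ω i = x i} =
        ENNReal.ofReal (π (x 0) * ∏ i ∈ Finset.range n, P (x i) (x (i + 1))))
    {n : ℕ} {S : Set (ℕ → 𝔛)} {f : ℕ → 𝔛}
    (hS : ∀ ω ω', (∀ i ≤ n, ω i = ω' i) → ω ∈ S → ω' ∈ S) (hx : ∀ ω ∈ S, ω n = f 0) (m : ℕ) :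
    μ (S ∩ {ω | ∀ i ≤ m, ω (n + i) = f i}) =
      μ S * ENNReal.ofReal (∏ i ∈ Finset.range m, P (f i) (f (i + 1))) := by
  induction m with
  | zero =>
    rw [Set.inter_eq_left.2 fun ω hω => by simpa using hx ω hω]
    simp
  | succ m ih =>
    have hset : S ∩ {ω | ∀ i ≤ m + 1, ω (n + i) = f i} =
        S ∩ {ω | ∀ i ≤ m, ω (n + i) = f i} ∩ {ω | ω (n + m + 1) = f (m + 1)} := by
      ext ω
      simp only [Set.mem_inter_iff, Set.mem_ofPred_eq, Nat.le_succ_iff, or_imp, forall_and,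
        forall_eq, and_assoc, Nat.add_assoc]
    rw [hset, measure_inter_next_eq (x := f m) hP0 hπ0 hμ ?_ fun ω hω => hω.2 m le_rfl, ih,
      Finset.prod_range_succ, ENNReal.ofReal_mul (Finset.prod_nonneg fun i _ => hP0 _ _),
      mul_assoc]
    rintro ω ω' h ⟨hω, hrun⟩
    exact ⟨hS ω ω' (fun i hi => h i (by omega)) hω,
      fun i hi => (h (n + i) (by omega)).symm.trans (hrun i hi)⟩

/-- The probability of leaving a finite set at the next step. -/
lemma measure_inter_exit_eq [IsFiniteMeasure μ] (hP0 : ∀ x y, 0 ≤ P x y) (hπ0 : ∀ x, 0 ≤ π x)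
    (hμ : ∀ (n : ℕ) (x : ℕ → 𝔛),
      μ {ω | ∀ i ≤ n, ω i = x i} =
        ENNReal.ofReal (π (x 0) * ∏ i ∈ Finset.range n, P (x i) (x (i + 1))))
    {n : ℕ} {S : Set (ℕ → 𝔛)} {x : 𝔛}
    (hS : ∀ ω ω', (∀ i ≤ n, ω i = ω' i) → ω ∈ S → ω' ∈ S) (hx : ∀ ω ∈ S, ω n = x)
    (F : Finset 𝔛) :
    μ (S ∩ {ω | ω (n + 1) ∉ F}) = μ S * ENNReal.ofReal (1 - ∑ y ∈ F, P x y) := by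
  have hm (A : Set 𝔛) : MeasurableSet ((fun ω : ℕ → 𝔛 => ω (n + 1)) ⁻¹' A) :=
    measurableSet_coord_mem (n + 1) A
  have hin : μ (S ∩ (fun ω : ℕ → 𝔛 => ω (n + 1)) ⁻¹' F) =
      μ S * ENNReal.ofReal (∑ y ∈ F, P x y) := by
    rw [Set.inter_comm, ← Measure.restrict_apply (hm _),
      ← sum_measure_preimage_singleton F fun y _ => hm {y},
      ENNReal.ofReal_sum_of_nonneg fun y _ => hP0 x y, Finset.mul_sum]
    refine Finset.sum_congr rfl fun y _ => ?_
    rw [Measure.restrict_apply (hm _), Set.inter_comm]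
    exact measure_inter_next_eq hP0 hπ0 hμ hS hx y
  have hsplit := measure_inter_add_sdiff (μ := μ) S (hm F)
  rw [ENNReal.ofReal_sub _ (Finset.sum_nonneg fun y _ => hP0 x y), ENNReal.ofReal_one,
    ENNReal.mul_sub fun _ _ => measure_ne_top μ S, mul_one, ← hin]
  exact ENNReal.eq_sub_of_add_eq (measure_ne_top _ _) (by rw [add_comm]; exact hsplit)

lemma isProbabilityMeasure_of_initial (hπ0 : ∀ x, 0 ≤ π x) (hπ1 : ∑' x, π x = 1)
    (hμ : ∀ (n : ℕ) (x : ℕ → 𝔛),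
      μ {ω | ∀ i ≤ n, ω i = x i} =
        ENNReal.ofReal (π (x 0) * ∏ i ∈ Finset.range n, P (x i) (x (i + 1)))) :
    IsProbabilityMeasure μ := by
  have hs : Summable π := by
    by_contra h
    simp [tsum_eq_zero_of_not_summable h] at hπ1
  have h0 (x : 𝔛) : μ ((fun ω : ℕ → 𝔛 => ω 0) ⁻¹' {x}) = ENNReal.ofReal (π x) := by
    rw [show (fun ω : ℕ → 𝔛 => ω 0) ⁻¹' {x} = {ω | ∀ i ≤ 0, ω i = x} by ext; simp]
    simpa only [Finset.range_zero, Finset.prod_empty, mul_one] using hμ 0 fun _ => x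
  constructor
  rw [← Set.preimage_univ (f := fun ω : ℕ → 𝔛 => ω 0),
    ← tsum_measure_preimage_singleton Set.countable_univ
      fun x _ => measurable_pi_apply 0 (measurableSet_singleton x),
    tsum_univ fun x => μ ((fun ω : ℕ → 𝔛 => ω 0) ⁻¹' {x})]
  simp only [h0]
  rw [← ENNReal.ofReal_tsum_of_nonneg hπ0 hs, hπ1, ENNReal.ofReal_one]

/-- Almost every trajectory makes only transitions of positive probability. -/
lemma ae_transition_pos (hP0 : ∀ x y, 0 ≤ P x y) (hπ0 : ∀ x, 0 ≤ π x)
    (hμ : ∀ (n : ℕ) (x : ℕ → 𝔛),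
      μ {ω | ∀ i ≤ n, ω i = x i} =
        ENNReal.ofReal (π (x 0) * ∏ i ∈ Finset.range n, P (x i) (x (i + 1)))) :
    ∀ᵐ ω ∂μ, ∀ n, 0 < P (ω n) (ω (n + 1)) := by
  have h : ∀ᵐ ω ∂μ, ∀ n x y, ω n = x → ω (n + 1) = y → 0 < P x y := by
    simp only [ae_all_iff]
    intro n x y
    by_cases hxy : 0 < P x y
    · simp [hxy]
    rw [ae_iff]
    have hnext := measure_inter_next_eq (S := {ω | ω n = x}) (x := x) hP0 hπ0 hμ
      (fun ω ω' h hω => (h n le_rfl).symm.trans hω) (fun ω hω => hω) y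
    rw [le_antisymm (not_lt.1 hxy) (hP0 x y), ENNReal.ofReal_zero, mul_zero] at hnext
    refine measure_mono_null (fun ω hω => ?_) hnext
    simp only [Set.mem_ofPred_eq, Classical.not_imp] at hω
    exact ⟨hω.1, hω.2.1⟩
  filter_upwards [h] with ω hω n using hω n _ _ rfl rfl

/-- The probability of entering `F` at `f 0`, running through `f 0, …, f m` and then leaving. -/
lemma measure_run_eq [IsFiniteMeasure μ] (hP0 : ∀ x y, 0 ≤ P x y) (hπ0 : ∀ x, 0 ≤ π x)
    (hμ : ∀ (n : ℕ) (x : ℕ → 𝔛),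
      μ {ω | ∀ i ≤ n, ω i = x i} =
        ENNReal.ofReal (π (x 0) * ∏ i ∈ Finset.range n, P (x i) (x (i + 1))))
    (F : Finset 𝔛) {f : ℕ → 𝔛} (hf : f 0 ∈ F) (m : ℕ) :
    μ {ω | ∃ n, ((∀ k < n, ω k ∉ F) ∧ ω n = f 0) ∧ (∀ i ≤ m, ω (n + i) = f i) ∧
        ω (n + m + 1) ∉ F} =
      μ {ω | ∃ n, ω n = f 0 ∧ ∀ k < n, ω k ∉ F} *
        ENNReal.ofReal (∏ i ∈ Finset.range m, P (f i) (f (i + 1))) *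
        ENNReal.ofReal (1 - ∑ y ∈ F, P (f m) y) := by
  set A : ℕ → Set (ℕ → 𝔛) := fun n => {ω | (∀ k < n, ω k ∉ F) ∧ ω n = f 0} with hA
  set C : ℕ → Set (ℕ → 𝔛) := fun n =>
    A n ∩ {ω | ∀ i ≤ m, ω (n + i) = f i} ∩ {ω | ω (n + m + 1) ∉ F} with hC
  have hAm (n : ℕ) : MeasurableSet (A n) := by
    have h1 : MeasurableSet {ω : ℕ → 𝔛 | ∀ k < n, ω k ∉ F} := by
      simp only [Set.ofPred_forall]
      exact .iInter fun k => .iInter fun _ => measurableSet_coord_mem k {x | x ∉ F}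
    exact h1.inter (measurableSet_coord_mem n {f 0})
  have hCm (n : ℕ) : MeasurableSet (C n) := by
    have h1 : MeasurableSet {ω : ℕ → 𝔛 | ∀ i ≤ m, ω (n + i) = f i} := by
      simp only [Set.ofPred_forall]
      exact .iInter fun i => .iInter fun _ => measurableSet_coord_mem (n + i) {f i}
    exact ((hAm n).inter h1).inter (measurableSet_coord_mem (n + m + 1) {x | x ∉ F})
  have hAd : Pairwise (Function.onFun Disjoint A) := by
    have key {i j : ℕ} (hij : i < j) : Disjoint (A i) (A j) :=
      Set.disjoint_left.2 fun ω hi hj => hj.1 i hij (hi.2 ▸ hf)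
    intro i j hij
    rcases hij.lt_or_gt with h | h
    · exact key h
    · exact (key h).symm
  have hCd : Pairwise (Function.onFun Disjoint C) := fun i j hij =>
    (hAd hij).mono (fun ω h => h.1.1) fun ω h => h.1.1
  have hAS (n : ℕ) : ∀ ω ω', (∀ i ≤ n, ω i = ω' i) → ω ∈ A n → ω' ∈ A n :=
    fun ω ω' h hω => ⟨fun k hk => h k hk.le ▸ hω.1 k hk, h n le_rfl ▸ hω.2⟩
  have hCμ (n : ℕ) : μ (C n) =
      μ (A n) * (ENNReal.ofReal (∏ i ∈ Finset.range m, P (f i) (f (i + 1))) *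
        ENNReal.ofReal (1 - ∑ y ∈ F, P (f m) y)) := by
    rw [hC, measure_inter_exit_eq (x := f m) hP0 hπ0 hμ ?_ (fun ω hω => hω.2 m le_rfl) F,
      measure_inter_run_eq hP0 hπ0 hμ (hAS n) (fun ω hω => hω.2) m, mul_assoc]
    rintro ω ω' h ⟨hω, hrun⟩
    exact ⟨hAS n ω ω' (fun i hi => h i (by omega)) hω,
      fun i hi => (h (n + i) (by omega)).symm.trans (hrun i hi)⟩
  have hCU : {ω | ∃ n, ((∀ k < n, ω k ∉ F) ∧ ω n = f 0) ∧ (∀ i ≤ m, ω (n + i) = f i) ∧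
      ω (n + m + 1) ∉ F} = ⋃ n, C n := by
    ext ω
    simp [hC, hA, and_assoc]
  have hAU : {ω | ∃ n, ω n = f 0 ∧ ∀ k < n, ω k ∉ F} = ⋃ n, A n := by
    ext ω
    simp [hA, and_comm]
  rw [hCU, hAU, measure_iUnion hCd hCm, measure_iUnion hAd hAm, mul_assoc,
    ← ENNReal.tsum_mul_right]
  exact tsum_congr hCμ

/-- The first-hit distribution on `F` has total mass the probability of hitting `F`. -/
lemma measure_avoid_add_sum_firstHit [IsProbabilityMeasure μ] (F : Finset 𝔛) :
    (μ {ω | ∀ m : ℕ, ω m ∉ F}).toReal +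
      ∑ x ∈ F, (μ {ω | ∃ m : ℕ, ω m = x ∧ ∀ k < m, ω k ∉ F}).toReal = 1 := by
  have hm0 : MeasurableSet {ω : ℕ → 𝔛 | ∀ m : ℕ, ω m ∉ F} := by
    simp only [Set.ofPred_forall]
    exact .iInter fun k => measurableSet_coord_mem k {x | x ∉ F}
  have hm (x : 𝔛) : MeasurableSet {ω : ℕ → 𝔛 | ∃ m : ℕ, ω m = x ∧ ∀ k < m, ω k ∉ F} := by
    simp only [Set.ofPred_exists, Set.ofPred_and, Set.ofPred_forall]
    exact .iUnion fun m => (measurableSet_coord_mem m {x}).inter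
      (.iInter fun k => .iInter fun _ => measurableSet_coord_mem k {x | x ∉ F})
  have hd : (F : Set 𝔛).PairwiseDisjoint
      fun x => {ω : ℕ → 𝔛 | ∃ m : ℕ, ω m = x ∧ ∀ k < m, ω k ∉ F} := by
    intro x hx y hy hxy
    refine Set.disjoint_left.2 ?_
    rintro ω ⟨m, rfl, hm⟩ ⟨m', rfl, hm'⟩
    rcases lt_trichotomy m m' with h | h | h
    · exact hm' m h hx
    · exact hxy (by rw [h])
    · exact hm m' h hy
  have hU : ⋃ x ∈ F, {ω : ℕ → 𝔛 | ∃ m : ℕ, ω m = x ∧ ∀ k < m, ω k ∉ F} =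
      {ω : ℕ → 𝔛 | ∀ m : ℕ, ω m ∉ F}ᶜ := by
    ext ω
    simp only [Set.mem_iUnion, Set.mem_ofPred_eq, exists_prop, Set.mem_compl_iff, not_forall,
      not_not]
    constructor
    · rintro ⟨x, hx, m, rfl, -⟩
      exact ⟨m, hx⟩
    · intro h
      classical
      exact ⟨_, Nat.find_spec h, Nat.find h, rfl, fun k hk => Nat.find_min h hk⟩
  have hsum := measureReal_biUnion_finset (μ := μ) hd fun x _ => hm x
  rw [hU] at hsum
  have hcompl := probReal_add_probReal_compl (μ := μ) hm0
  rw [hsum] at hcompl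
  exact hcompl

end MarkovChain

/-- Key computation in the proof of Theorem 1.3: the principal minors of the
matrix `L x y = π̃ x * P_{y𝓕} / π₀ - P y x` on a no-return window `𝔜` give, up
to the factor `π₀⁻¹`, the exact hitting-set probabilities; in particular
`det (1 + L) = π₀⁻¹`. -/
theorem L_minors_eq_hitting_probabilities {𝔛 : Type*} [Countable 𝔛] [DecidableEq 𝔛]
    [MeasurableSpace 𝔛] [MeasurableSingletonClass 𝔛]
    (P : 𝔛 → 𝔛 → ℝ) (π : 𝔛 → ℝ)
    (hP0 : ∀ x y, 0 ≤ P x y) (hP1 : ∀ x y, P x y ≤ 1)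
    (hstoch : ∀ x, ∑' y, P x y = 1)
    (hloop : ∀ (x : 𝔛) (k : ℕ), 1 ≤ k → powMat P k x x = 0)
    (hπ0 : ∀ x, 0 ≤ π x) (hπ1 : ∑' x, π x = 1)
    (μ : Measure (ℕ → 𝔛))
    (hμ : ∀ (n : ℕ) (x : ℕ → 𝔛),
      μ {ω | ∀ i ≤ n, ω i = x i} =
        ENNReal.ofReal (π (x 0) * ∏ i ∈ Finset.range n, P (x i) (x (i + 1))))
    (𝔜 : Finset 𝔛)
    (hnoreturn : ∀ y ∈ 𝔜, ∀ z ∉ 𝔜, 0 < Qmat P y z → ∀ y' ∈ 𝔜, Qmat P z y' = 0)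
    (π₀ : ℝ) (hπ₀ : π₀ = (μ {ω | ∀ m : ℕ, ω m ∉ 𝔜}).toReal) (hπ₀ne : π₀ ≠ 0)
    (π' : 𝔛 → ℝ)
    (hπ' : ∀ x, π' x = (μ {ω | ∃ m : ℕ, ω m = x ∧ ∀ k < m, ω k ∉ 𝔜}).toReal)
    (L : 𝔛 → 𝔛 → ℝ)
    (hL : ∀ x y, L x y = π' x * (1 - ∑ y' ∈ 𝔜, P y y') / π₀ - P y x) :
    (∀ Y : Finset 𝔛, Y ⊆ 𝔜 →
      Matrix.det (Matrix.of fun x y : ↥Y => L (x : 𝔛) (y : 𝔛)) =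
        π₀⁻¹ * (μ {ω | ∀ x ∈ 𝔜, (x ∈ Y ↔ ∃ m : ℕ, ω m = x)}).toReal) ∧
    Matrix.det (1 + Matrix.of fun x y : ↥𝔜 => L (x : 𝔛) (y : 𝔛)) = π₀⁻¹ := by

  have hprob := isProbabilityMeasure_of_initial hπ0 hπ1 hμ
  set r : 𝔛 → 𝔛 → Prop := Relation.TransGen fun x y => 0 < P x y with hr
  have hirr : ∀ x, ¬ r x x := not_transGen_self hP0 hstoch hloop
  have hQ {x y : 𝔛} (h : r x y) : 0 < Qmat P x y := Qmat_pos_of_transGen hP0 hstoch hloop h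
  have hno : ∀ y ∈ 𝔜, ∀ z ∉ 𝔜, r y z → ∀ y' ∈ 𝔜, ¬ r z y' := fun y hy z hz hyz y' hy' hzy' =>
    (hQ hzy').ne' (hnoreturn y hy z hz (hQ hyz) y' hy')
  have hae : ∀ᵐ ω ∂μ, ∀ i j, i < j → r (ω i) (ω j) := by
    filter_upwards [ae_transition_pos hP0 hπ0 hμ] with ω hω i j hij
    exact Nat.rel_of_forall_rel_succ_of_lt r (fun n => .single (hω n)) hij
  have hP_zero {ι : Type} [LinearOrder ι] {s : Finset 𝔛} {e : ι → s}
      (he : ∀ i j, r (e i) (e j) → i < j) (i j : ι) (hij : j ≤ i) : P (e i) (e j) = 0 := by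
    by_contra hne
    exact hij.not_gt (he i j (.single ((hP0 _ _).lt_of_ne' hne)))
  refine ⟨fun Y hY => ?_, ?_⟩
  · rcases Y.eq_empty_or_nonempty with rfl | hne
    · have hset : {ω : ℕ → 𝔛 | ∀ x ∈ 𝔜, (x ∈ (∅ : Finset 𝔛) ↔ ∃ m : ℕ, ω m = x)} =
          {ω | ∀ m : ℕ, ω m ∉ 𝔜} := by
        ext ω
        simp only [Finset.notMem_empty, false_iff, not_exists, Set.mem_ofPred_eq]
        exact ⟨fun h m hm => h _ hm m rfl, fun h x hx m hm => h m (hm ▸ hx)⟩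
      rw [hset, ← hπ₀, inv_mul_cancel₀ hπ₀ne, Matrix.det_isEmpty]
    obtain ⟨m, hm⟩ := Nat.exists_eq_add_one.2 hne.card_pos
    obtain ⟨e, he⟩ := exists_enumeration r hirr Y hm
    set f : ℕ → 𝔛 := fun i => e (Fin.ofNat (m + 1) i) with hf
    have hfe (i : ℕ) (hi : i ≤ m) : f i = e ⟨i, by omega⟩ := by
      have : Fin.ofNat (m + 1) i = ⟨i, by omega⟩ := Fin.ext (Nat.mod_eq_of_lt (by omega))
      rw [hf, ← this]
    have hfY (i : ℕ) (_ : i ≤ m) : f i ∈ Y := (e _).2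
    have hev : (μ {ω | ∀ x ∈ 𝔜, (x ∈ Y ↔ ∃ m : ℕ, ω m = x)}) =
        μ {ω | ∃ n, ((∀ k < n, ω k ∉ 𝔜) ∧ ω n = f 0) ∧ (∀ i ≤ m, ω (n + i) = f i) ∧
          ω (n + m + 1) ∉ 𝔜} := by
      refine measure_congr ?_
      filter_upwards [hae] with ω hω
      refine propext (trajectory_inter_eq_iff hirr hω hY hno hfY ?_ ?_ ?_)
      · intro x hx
        obtain ⟨i, hi⟩ := e.surjective ⟨x, hx⟩
        exact ⟨i, Nat.lt_succ_iff.1 i.2, by rw [hfe i (Nat.lt_succ_iff.1 i.2), Fin.eta, hi]⟩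
      · intro i hi j hj hij
        rw [hfe i hi, hfe j hj] at hij
        exact congrArg Fin.val (e.injective (Subtype.ext hij))
      · intro i hi j hj hij
        rw [hfe i hi, hfe j hj] at hij
        exact he _ _ hij
    have hexit : 0 ≤ 1 - ∑ y' ∈ 𝔜, P (f m) y' :=
      sub_nonneg.2 (hstoch (f m) ▸
        (summable_row hstoch (f m)).sum_le_tsum 𝔜 fun y _ => hP0 _ y)
    rw [hev, measure_run_eq hP0 hπ0 hμ 𝔜 (hY (hfY 0 (Nat.zero_le m))), ENNReal.toReal_mul,
      ENNReal.toReal_mul, ← hπ', ENNReal.toReal_ofReal hexit,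
      ENNReal.toReal_ofReal (Finset.prod_nonneg fun i _ => hP0 _ _),
      ← Matrix.det_submatrix_equiv_self e]
    have hdet := det_mul_sub_of_strictly_triangular (fun i => π' (e i) / π₀)
      (fun j => 1 - ∑ y' ∈ 𝔜, P (e j) y') (fun i j => P (e i) (e j)) (hP_zero he)
    have hmat : (Matrix.of fun x y : Y => L x y).submatrix e e =
        Matrix.of fun i j => π' (e i) / π₀ * (1 - ∑ y' ∈ 𝔜, P (e j) y') - P (e j) (e i) := by
      ext i j
      simp only [Matrix.submatrix_apply, Matrix.of_apply, hL]
      ring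
    have hprod : ∏ i ∈ Finset.range m, P (f i) (f (i + 1)) =
        ∏ i : Fin m, P (e i.castSucc) (e i.succ) := by
      rw [Finset.prod_range]
      refine Finset.prod_congr rfl fun i _ => ?_
      rw [hfe i (by omega), hfe (i + 1) (by omega)]
      rfl
    rw [hmat, hdet, hprod, hfe 0 (Nat.zero_le m), hfe m le_rfl]
    simp only [Fin.last, Fin.zero_eta]
    ring
  · obtain ⟨e, he⟩ := exists_enumeration r hirr 𝔜 rfl
    have hmat : (Matrix.of fun x y : 𝔜 => L x y) =
        Matrix.of fun x y : 𝔜 => π' x / π₀ * (1 - ∑ y' ∈ 𝔜, P y y') - P y x := by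
      ext x y
      simp only [Matrix.of_apply, hL]
      ring
    have hdet := det_one_add_of_strictly_triangular e (fun x => π' x / π₀)
      (fun y => 1 - ∑ y' ∈ 𝔜, P y y') (fun x y => P x y) (hP_zero he)
      fun y => by rw [Finset.sum_coe_sort 𝔜 fun z => P y z]
    have htot := measure_avoid_add_sum_firstHit (μ := μ) 𝔜
    simp only [← hπ', ← hπ₀] at htot
    rw [hmat, hdet, Finset.sum_coe_sort 𝔜 fun x => π' x / π₀, ← Finset.sum_div]
    field_simp
    exact htot
end

section
/- Let 𝔛 be a finite set, and let μ : 2^𝔛 → [0,1] be a probability measure on subsets of 𝔛 (∑_{X⊆𝔛} μ(X) = 1) which is determinantal with kernel K: for every Y ⊆ 𝔛, ∑_{X ⊇ Y} μ(X) = det(K|_{Y×Y}). Given p, q : 𝔛 → [0,1], define the noisy measure μ^{(p,q)}(Z) = ∑_{X⊆𝔛} μ(X) · ∏_{x∈X∩Z}(1−p_x) · ∏_{x∈X∖Z} p_x · ∏_{x∈Z∖X} q_x · ∏_{x∉X∪Z}(1−q_x). Then μ^{(p,q)} is determinantal with kernel K^{(p,q)} = diag(q_x) + diag(1 − p_x −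 q_x)·K, i.e., for every Y ⊆ 𝔛, ∑_{Z ⊇ Y} μ^{(p,q)}(Z) = det(K^{(p,q)}|_{Y×Y}). -/
open scoped BigOperators

/-- The determinant of `diag(q) + diag(d) * A` expands over the principal minors of `A`. -/
theorem Matrix.det_diagonal_add_diagonal_mul_eq_sum_minors {n R : Type*} [Fintype n]
    [DecidableEq n] [CommRing R] (A : Matrix n n R) (d q : n → R) :
    (Matrix.diagonal q + Matrix.diagonal d * A).det =
      ∑ s : Finset n, (∏ i ∈ s, d i) * (∏ i ∈ sᶜ, q i) *
        (A.submatrix (Subtype.val : s → n) (Subtype.val : s → n)).det := by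
  rw [add_comm]
  refine (Matrix.detRowAlternating.map_add_univ (Matrix.diagonal d * A).row
    (Matrix.diagonal q).row).trans (Finset.sum_congr rfl fun s _ => ?_)
  have hrow : Matrix.of (s.piecewise (Matrix.diagonal d * A).row (Matrix.diagonal q).row) =
      Matrix.of fun i j => s.piecewise d q i *
        Matrix.of (s.piecewise A.row (1 : Matrix n n R).row) i j := by
    ext i j
    by_cases hi : i ∈ s <;> simp [hi, Matrix.diagonal_apply, Matrix.one_apply]
  calc Matrix.det (Matrix.of (s.piecewise (Matrix.diagonal d * A).row (Matrix.diagonal q).row))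
      = (∏ i, s.piecewise d q i) *
          Matrix.det (Matrix.of (s.piecewise A.row (1 : Matrix n n R).row)) := by
        rw [hrow, Matrix.det_mul_column]
    _ = _ := by
        rw [Matrix.det_piecewise_one_eq_submatrix_det, Finset.prod_piecewise]
        simp [Finset.compl_eq_univ_sdiff]

/-- Product weights summed over all supersets of `Y` factor over the sites of `Y`,
provided the two weights at every site add up to `1`. -/
theorem Finset.sum_superset_prod_mul_prod_compl {ι R : Type*} [Fintype ι] [DecidableEq ι]
    [CommSemiring R] (a b : ι → R) (hab : ∀ i, a i + b i = 1) (Y : Finset ι) :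
    ∑ Z ∈ Finset.univ.filter (fun Z : Finset ι => Y ⊆ Z), (∏ i ∈ Z, a i) * ∏ i ∈ Zᶜ, b i =
      ∏ i ∈ Y, a i := by
  calc _ = ∑ Z : Finset ι, (∏ i ∈ Z, a i) * ∏ i ∈ Zᶜ, (if i ∈ Y then 0 else b i) := by
        rw [Finset.sum_filter]
        refine Finset.sum_congr rfl fun Z _ => ?_
        split_ifs with h
        · congr 1
          refine Finset.prod_congr rfl fun i hi => ?_
          rw [if_neg fun hY => Finset.mem_compl.1 hi (h hY)]
        · obtain ⟨i, hiY, hiZ⟩ := Finset.not_subset.1 h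
          have hzero : ∏ i ∈ Zᶜ, (if i ∈ Y then 0 else b i) = 0 :=
            Finset.prod_eq_zero (Finset.mem_compl.2 hiZ) (if_pos hiY)
          rw [hzero, mul_zero]
    _ = ∏ i, (a i + if i ∈ Y then 0 else b i) := (Fintype.prod_add _ _).symm
    _ = ∏ i, if i ∈ Y then a i else 1 := by
        refine Finset.prod_congr rfl fun i _ => ?_
        split_ifs <;> simp [hab]
    _ = ∏ i ∈ Y, a i := by simp

/-- The Bernoulli noise transition weight from `X` to `Z` as a product over sites. -/
theorem bernoulli_noise_weight_eq {ι R : Type*} [Fintype ι] [DecidableEq ι] [CommRing R]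
    (p q : ι → R) (X Z : Finset ι) :
    (∏ x ∈ X ∩ Z, (1 - p x)) * (∏ x ∈ X \ Z, p x) *
        (∏ x ∈ Z \ X, q x) * (∏ x ∈ Finset.univ \ (X ∪ Z), (1 - q x)) =
      (∏ x ∈ Z, if x ∈ X then 1 - p x else q x) *
        ∏ x ∈ Zᶜ, if x ∈ X then p x else 1 - q x := by
  have h₁ : Z.filter (· ∈ X) = X ∩ Z := by grind
  have h₂ : Z.filter (· ∉ X) = Z \ X := by grind
  have h₃ : Zᶜ.filter (· ∈ X) = X \ Z := by grind [Finset.mem_compl]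
  have h₄ : Zᶜ.filter (· ∉ X) = Finset.univ \ (X ∪ Z) := by grind [Finset.mem_compl]
  rw [Finset.prod_ite, Finset.prod_ite, h₁, h₂, h₃, h₄]
  ring

/-- Theorem 2.1 (on a finite ground set): if `μ` is a determinantal probability
measure on subsets of `𝔛` with kernel `K`, then the measure obtained by applying
Bernoulli noise (removing each particle `x` with probability `p x`, adding a
particle at each empty site `x` with probability `q x`, independently) is
determinantal with kernel `K^{(p,q)} = diag(q) + diag(1 - p - q) • K`. -/
theorem bernoulli_noise_determinantal {𝔛 : Type*} [Fintype 𝔛] [DecidableEq 𝔛]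
    (μ : Finset 𝔛 → ℝ) (K : Matrix 𝔛 𝔛 ℝ) (p q : 𝔛 → ℝ)
    (hμ0 : ∀ X, 0 ≤ μ X) (hμ1 : ∑ X : Finset 𝔛, μ X = 1)
    (hp : ∀ x, p x ∈ Set.Icc (0 : ℝ) 1) (hq : ∀ x, q x ∈ Set.Icc (0 : ℝ) 1)
    (hdet : ∀ Y : Finset 𝔛,
      ∑ X ∈ Finset.univ.filter (fun X : Finset 𝔛 => Y ⊆ X), μ X =
        Matrix.det (Matrix.of fun i j : ↥Y => K (i : 𝔛) (j : 𝔛))) :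
    ∀ Y : Finset 𝔛,
      ∑ Z ∈ Finset.univ.filter (fun Z : Finset 𝔛 => Y ⊆ Z),
        (∑ X : Finset 𝔛, μ X * (∏ x ∈ X ∩ Z, (1 - p x)) * (∏ x ∈ X \ Z, p x) *
          (∏ x ∈ Z \ X, q x) * (∏ x ∈ Finset.univ \ (X ∪ Z), (1 - q x))) =
      Matrix.det (Matrix.of fun i j : ↥Y =>
        (if (i : 𝔛) = (j : 𝔛) then q (i : 𝔛) else 0) +
          (1 - p (i : 𝔛) - q (i : 𝔛)) * K (i : 𝔛) (j : 𝔛)) := by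
  intro Y
  have hminor (s : Finset Y) :
      ((K.submatrix (Subtype.val : Y → 𝔛) (Subtype.val : Y → 𝔛)).submatrix
        (Subtype.val : s → Y) (Subtype.val : s → Y)).det =
      ∑ X : Finset 𝔛, μ X * ∏ y ∈ s, if (y : 𝔛) ∈ X then 1 else 0 := by
    calc _ = Matrix.det (Matrix.of fun i j : ↥(s.map (Function.Embedding.subtype (· ∈ Y))) =>
            K (i : 𝔛) (j : 𝔛)) :=
          Matrix.det_submatrix_equiv_self (Finset.equivMap (Function.Embedding.subtype (· ∈ Y)) s)
            (Matrix.of fun i j => K (i : 𝔛) (j : 𝔛))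
      _ = _ := by
          rw [← hdet, Finset.sum_filter]
          refine Finset.sum_congr rfl fun X _ => ?_
          rw [Finset.prod_ite_zero]
          simp [Finset.subset_iff]
  have hkernel : (Matrix.of fun i j : ↥Y => (if (i : 𝔛) = (j : 𝔛) then q (i : 𝔛) else 0) +
        (1 - p (i : 𝔛) - q (i : 𝔛)) * K (i : 𝔛) (j : 𝔛)) =
      Matrix.diagonal (fun y : Y => q y) + Matrix.diagonal (fun y : Y => 1 - p y - q y) *
        K.submatrix (Subtype.val : Y → 𝔛) (Subtype.val : Y → 𝔛) := by
    ext i j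
    simp [Matrix.diagonal_apply]
  rw [hkernel, Matrix.det_diagonal_add_diagonal_mul_eq_sum_minors]
  simp only [hminor, Finset.mul_sum]
  rw [Finset.sum_comm]
  refine Eq.trans ?_ Finset.sum_comm
  refine Finset.sum_congr rfl fun X _ => ?_
  calc _ = μ X * ∏ y ∈ Y, (if y ∈ X then 1 - p y else q y) := by
        rw [← Finset.sum_superset_prod_mul_prod_compl _ (fun x => if x ∈ X then p x else 1 - q x)
          (fun x => by split_ifs <;> ring), Finset.mul_sum]
        refine Finset.sum_congr rfl fun Z _ => ?_
        rw [← bernoulli_noise_weight_eq]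
        ring
    _ = μ X * ∏ y : Y, ((1 - p y - q y) * (if (y : 𝔛) ∈ X then 1 else 0) + q y) := by
        rw [← Finset.prod_coe_sort]
        congr 1
        refine Finset.prod_congr rfl fun y _ => ?_
        split_ifs <;> ring
    _ = _ := by
        rw [Fintype.prod_add, Finset.mul_sum]
        refine Finset.sum_congr rfl fun s _ => ?_
        rw [Finset.prod_mul_distrib]
        ring
end

section
/- Let p : ℤ_{>0} → [0,1] be a probability distribution (∑_{n≥1} p_n = 1) such that: (a) there exist r ∈ (0,1) and N₀ with p_n ≤ r^n for all n ≥ N₀ (class 𝓔); and (b) p is aperiodic: for every integer N ≥ 2 there exists n with p_n > 0 and N ∤ n. Let μ = ∑_{n≥1} n·p_n (finite by (a)), and define the renewal sequence u_n = ∑_{m=1}^{∞} p^{*m}(n), where p^{*m} is the m-fold convolution of p (only terms with m ≤ n are nonzero). Then there exist constants c₁, c₂ > 0 such that |u_n − μ^{-1}| ≤ c₁ e^{−c₂ n} for all n ≥ 1. -/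
open scoped BigOperators

/-- `m`-fold convolution power of a distribution `p` on `ℕ` (supported on `ℤ_{>0}`):
`convPow p 0 = δ₀` and `convPow p (m+1) n = ∑_{k=0}^{n} convPow p m k * p (n - k)`. -/
def convPow (p : ℕ → ℝ) : ℕ → ℕ → ℝ
  | 0 => fun n => if n = 0 then 1 else 0
  | m + 1 => fun n => ∑ k ∈ Finset.range (n + 1), convPow p m k * p (n - k)

open PowerSeries in
/-- The Cauchy product of two absolutely convergent power series is the sum of their product. -/
theorem hasSum_coeff_mul {R : Type*} [NormedCommRing R] [CompleteSpace R] (A B : R⟦X⟧) (z : R)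
    (hA : Summable fun n => ‖coeff n A * z ^ n‖) (hB : Summable fun n => ‖coeff n B * z ^ n‖) :
    HasSum (fun n => coeff n (A * B) * z ^ n)
      ((∑' n, coeff n A * z ^ n) * ∑' n, coeff n B * z ^ n) := by
  have hcoeff (n : ℕ) : coeff n (A * B) * z ^ n =
      ∑ kl ∈ Finset.HasAntidiagonal.antidiagonal n,
        coeff kl.1 A * z ^ kl.1 * (coeff kl.2 B * z ^ kl.2) := by
    rw [coeff_mul, Finset.sum_mul]
    refine Finset.sum_congr rfl fun kl hkl => ?_
    rw [← Finset.HasAntidiagonal.mem_antidiagonal.mp hkl, pow_add]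
    ring
  rw [tsum_mul_tsum_eq_tsum_sum_antidiagonal_of_summable_norm hA hB, funext hcoeff]
  exact (summable_norm_sum_mul_antidiagonal_of_summable_norm hA hB).of_norm.hasSum

open PowerSeries in
theorem hasSum_coeff_one {R : Type*} [CommRing R] [TopologicalSpace R] (z : R) :
    HasSum (fun n => coeff n (1 : R⟦X⟧) * z ^ n) 1 := by
  have h := hasSum_single (f := fun n => coeff n (1 : R⟦X⟧) * z ^ n) 0
    fun n hn => by simp [coeff_one, hn]
  simpa using h

open PowerSeries in
theorem PowerSeries.eq_of_eventually_hasSum {𝕜 : Type*} [NontriviallyNormedField 𝕜] {A B : 𝕜⟦X⟧}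
    {f : 𝕜 → 𝕜} (hA : ∀ᶠ z in nhds 0, HasSum (fun n => coeff n A * z ^ n) (f z))
    (hB : ∀ᶠ z in nhds 0, HasSum (fun n => coeff n B * z ^ n) (f z)) : A = B := by
  have key (D : 𝕜⟦X⟧) (hD : ∀ᶠ z in nhds 0, HasSum (fun n => coeff n D * z ^ n) (f z)) :
      HasFPowerSeriesAt f (FormalMultilinearSeries.ofScalars 𝕜 fun n => coeff n D) 0 := by
    rw [hasFPowerSeriesAt_iff]
    simpa [FormalMultilinearSeries.coeff_ofScalars, mul_comm] using hD
  ext n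
  have h := congrArg (fun s => s.coeff n) ((key A hA).eq_formalMultilinearSeries (key B hB))
  simpa only [FormalMultilinearSeries.coeff_ofScalars] using h

open PowerSeries in
/-- If the coefficients of `Q` decay geometrically and `Q` has no zero in the closed unit disc,
then the coefficients of its inverse decay geometrically. -/
theorem exists_geometric_bound_of_mul_eq_one {A Q : ℂ⟦X⟧} (hAQ : A * Q = 1) {C r : ℝ}
    (hr0 : 0 < r) (hr1 : r < 1) (hQ : ∀ n, ‖coeff n Q‖ ≤ C * r ^ n)
    (hne : ∀ z : ℂ, ‖z‖ ≤ 1 → ∑' n, coeff n Q * z ^ n ≠ 0) :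
    ∃ K s : ℝ, 0 < s ∧ s < 1 ∧ ∀ n, ‖coeff n A‖ ≤ K * s ^ n := by
  set q := FormalMultilinearSeries.ofScalars ℂ fun n => coeff n Q with hq
  let R : NNReal := ⟨r⁻¹, by positivity⟩
  have hR : (1 : ℝ) < R := (one_lt_inv₀ hr0).2 hr1
  have hRq : (R : ENNReal) ≤ q.radius := by
    refine q.le_radius_of_bound C fun n => ?_
    rw [hq, FormalMultilinearSeries.ofScalars_norm]
    change _ * r⁻¹ ^ n ≤ C
    calc _ ≤ C * r ^ n * r⁻¹ ^ n := by gcongr; exact hQ n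
      _ = C := by rw [mul_assoc, ← mul_pow, mul_inv_cancel₀ hr0.ne', one_pow, mul_one]
  have hR0 : (0 : ENNReal) < R := by
    exact_mod_cast (zero_lt_one.trans hR)
  have hqs := (q.hasFPowerSeriesOnBall (hR0.trans_le hRq)).mono hR0 hRq
  have hsum (z : ℂ) : q.sum z = ∑' n, coeff n Q * z ^ n := by
    simp [FormalMultilinearSeries.sum, hq, mul_comm]
  have hdiff : DifferentiableOn ℂ q.sum (Metric.ball 0 (R : ℝ)) := by
    have := hqs.differentiableOn
    rwa [Metric.eball_coe] at this
  have hopen : IsOpen (Metric.ball (0 : ℂ) R ∩ q.sum ⁻¹' {0}ᶜ) :=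
    hdiff.continuousOn.isOpen_inter_preimage Metric.isOpen_ball isOpen_compl_singleton
  obtain ⟨δ, hδ, hsub⟩ := (isCompact_closedBall (0 : ℂ) 1).exists_thickening_subset_open hopen
    (fun z hz => by
      rw [mem_closedBall_zero_iff] at hz
      refine ⟨by rw [mem_ball_zero_iff]; linarith, ?_⟩
      simpa [hsum] using hne z hz)
  rw [thickening_closedBall hδ zero_le_one] at hsub
  let ρ : NNReal := ⟨1 + δ / 2, by positivity⟩
  have hρ : (1 : ℝ) < ρ := by change (1 : ℝ) < 1 + δ / 2; linarith
  have hρ0 : 0 < ρ := by exact_mod_cast zero_lt_one.trans hρ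
  have hsub' : Metric.closedBall (0 : ℂ) ρ ⊆ Metric.ball 0 (δ + 1) :=
    Metric.closedBall_subset_ball (by change 1 + δ / 2 < δ + 1; linarith)
  have hF : DifferentiableOn ℂ (fun z => (q.sum z)⁻¹) (Metric.closedBall 0 ρ) :=
    (hdiff.mono fun z hz => (hsub (hsub' hz)).1).inv fun z hz => (hsub (hsub' hz)).2
  have hFs := hF.hasFPowerSeriesOnBall hρ0
  set a := cauchyPowerSeries (fun z => (q.sum z)⁻¹) 0 ρ
  have hmul : PowerSeries.mk a.coeff * Q = 1 := by
    refine PowerSeries.eq_of_eventually_hasSum (f := fun _ => 1) ?_ ?_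
    · have h1 := hasFPowerSeriesAt_iff.1 hFs.hasFPowerSeriesAt
      have h2 := hasFPowerSeriesAt_iff.1 hqs.hasFPowerSeriesAt
      filter_upwards [h1, h2, Metric.ball_mem_nhds (0 : ℂ) one_pos] with z hz1 hz2 hz3
      simp only [smul_eq_mul, zero_add, hq, FormalMultilinearSeries.coeff_ofScalars,
        mul_comm (z ^ _)] at hz1 hz2
      have := hasSum_coeff_mul (PowerSeries.mk a.coeff) Q z
        (by simpa only [coeff_mk] using hz1.summable.norm) hz2.summable.norm
      simp only [coeff_mk] at this
      rw [hz1.tsum_eq, hz2.tsum_eq] at this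
      rwa [inv_mul_cancel₀] at this
      rw [← hq, hsum]
      exact hne z (mem_ball_zero_iff.1 hz3).le
    · exact Filter.Eventually.of_forall hasSum_coeff_one
  have hA : A = PowerSeries.mk a.coeff :=
    (left_inv_eq_right_inv hmul (by rw [mul_comm, hAQ])).symm
  obtain ⟨s, hs1, hsρ⟩ := exists_between hρ
  lift s to NNReal using by linarith
  obtain ⟨K, -, hK⟩ := a.norm_mul_pow_le_of_lt_radius (r := s)
    (lt_of_lt_of_le (by exact_mod_cast hsρ) hFs.r_le)
  have hs0 : (0 : ℝ) < s := by linarith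
  refine ⟨K, (s : ℝ)⁻¹, by positivity, inv_lt_one_of_one_lt₀ hs1, fun n => ?_⟩
  rw [hA, coeff_mk, ← FormalMultilinearSeries.norm_apply_eq_norm_coef, inv_pow,
    ← div_eq_mul_inv, le_div_iff₀ (by positivity)]
  exact hK n

theorem summable_of_le_geometric {p : ℕ → ℝ} (hp : ∀ n, 0 ≤ p n) {C r : ℝ} (hr0 : 0 ≤ r)
    (hr1 : r < 1) (h : ∀ n, p n ≤ C * r ^ n) : Summable p :=
  .of_nonneg_of_le hp h ((summable_geometric_of_lt_one hr0 hr1).mul_left C)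

/-- An eventual geometric bound holds everywhere after enlarging the constant. -/
theorem exists_le_geometric_of_eventually {p : ℕ → ℝ} {r : ℝ} (hr0 : 0 < r) {N₀ : ℕ}
    (h : ∀ n ≥ N₀, p n ≤ r ^ n) : ∃ C > 0, ∀ n, p n ≤ C * r ^ n := by
  refine ⟨1 + ∑ k ∈ Finset.range N₀, |p k| / r ^ k, by positivity, fun n => ?_⟩
  rw [← div_le_iff₀ (by positivity)]
  rcases lt_or_ge n N₀ with hn | hn
  · have h1 : |p n| / r ^ n ≤ ∑ k ∈ Finset.range N₀, |p k| / r ^ k :=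
      Finset.single_le_sum (f := fun k => |p k| / r ^ k) (fun k _ => by positivity)
        (Finset.mem_range.2 hn)
    have h2 : p n / r ^ n ≤ |p n| / r ^ n := by gcongr; exact le_abs_self _
    linarith
  · have h1 : p n / r ^ n ≤ 1 := (div_le_one (by positivity)).2 (h n hn)
    have h2 : 0 ≤ ∑ k ∈ Finset.range N₀, |p k| / r ^ k := by positivity
    linarith

/-- The tail `∑_{k > n} p k` of a probability distribution `p`. -/
noncomputable def tailProb (p : ℕ → ℝ) (n : ℕ) : ℝ := 1 - ∑ k ∈ Finset.range (n + 1), p k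

theorem tailProb_succ (p : ℕ → ℝ) (n : ℕ) : tailProb p (n + 1) = tailProb p n - p (n + 1) := by
  rw [tailProb, Finset.sum_range_succ, tailProb]
  ring

theorem hasSum_tailProb {p : ℕ → ℝ} (hp : HasSum p 1) (n : ℕ) :
    HasSum (fun k => p (k + (n + 1))) (tailProb p n) :=
  (hasSum_nat_add_iff' (n + 1)).2 hp

theorem tailProb_nonneg {p : ℕ → ℝ} (hp : HasSum p 1) (hp0 : ∀ n, 0 ≤ p n) (n : ℕ) :
    0 ≤ tailProb p n :=
  (hasSum_tailProb hp n).nonneg fun _ => hp0 _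

theorem tailProb_le_geometric {p : ℕ → ℝ} (hp : HasSum p 1) {C r : ℝ} (hr0 : 0 ≤ r) (hr1 : r < 1)
    (h : ∀ n, p n ≤ C * r ^ n) (n : ℕ) : tailProb p n ≤ C * r / (1 - r) * r ^ n := by
  refine hasSum_le (fun k => h (k + (n + 1))) (hasSum_tailProb hp n) ?_
  have := (hasSum_geometric_of_lt_one hr0 hr1).mul_left (C * r * r ^ n)
  have hval : C * r * r ^ n * (1 - r)⁻¹ = C * r / (1 - r) * r ^ n := by ring
  have hfun : (fun k => C * r * r ^ n * r ^ k) = fun k => C * r ^ (k + (n + 1)) := by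
    ext k
    ring
  rwa [hval, hfun] at this

theorem sum_tailProb (p : ℕ → ℝ) (N : ℕ) :
    ∑ n ∈ Finset.range N, tailProb p n =
      ∑ k ∈ Finset.range (N + 1), (k : ℝ) * p k + N * tailProb p N := by
  induction N with
  | zero => simp
  | succ N ih =>
    rw [Finset.sum_range_succ, ih, Finset.sum_range_succ _ (N + 1), tailProb_succ]
    push_cast
    ring

/-- The mean of a distribution on `ℕ` is the sum of its tails. -/
theorem tsum_tailProb_eq_mean {p : ℕ → ℝ} (hp : HasSum p 1) (hp0 : ∀ n, 0 ≤ p n) {C r : ℝ}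
    (hr0 : 0 ≤ r) (hr1 : r < 1) (h : ∀ n, tailProb p n ≤ C * r ^ n) :
    ∑' n, tailProb p n = ∑' n : ℕ, (n : ℝ) * p n := by
  have hq0 := tailProb_nonneg hp hp0
  have hlim : Filter.Tendsto (fun n : ℕ => (n : ℝ) * tailProb p n) Filter.atTop (nhds 0) := by
    have := (tendsto_self_mul_const_pow_of_lt_one hr0 hr1).const_mul C
    rw [mul_zero] at this
    refine squeeze_zero (fun n => mul_nonneg n.cast_nonneg (hq0 n)) (fun n => ?_) this
    calc (n : ℝ) * tailProb p n ≤ n * (C * r ^ n) := by gcongr; exact h n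
      _ = _ := by ring
  have hsum := (summable_of_le_geometric hq0 hr0 hr1 h).hasSum.tendsto_sum_nat.sub hlim
  simp only [sum_tailProb, add_sub_cancel_right, sub_zero] at hsum
  refine ((hasSum_iff_tendsto_nat_of_nonneg
    (fun n => mul_nonneg n.cast_nonneg (hp0 n)) _).2 ?_).tsum_eq.symm
  exact (Filter.tendsto_add_atTop_iff_nat 1).1 hsum

open PowerSeries in
theorem mk_tailProb_mul {p : ℕ → ℝ} (hp0 : p 0 = 0) :
    PowerSeries.mk (tailProb p) * (1 - X) = 1 - PowerSeries.mk p := by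
  ext n
  cases n with
  | zero => simp [tailProb, hp0, coeff_zero_eq_constantCoeff]
  | succ n =>
    rw [mul_sub, mul_one, map_sub, coeff_succ_mul_X]
    simp [tailProb_succ, coeff_one]

open PowerSeries in
theorem convPow_eq_coeff (p : ℕ → ℝ) (m n : ℕ) :
    convPow p m n = coeff n (PowerSeries.mk p ^ m) := by
  induction m generalizing n with
  | zero => simp [convPow, coeff_one]
  | succ m ih =>
    rw [pow_succ, coeff_mul, Finset.Nat.sum_antidiagonal_eq_sum_range_succ
      (fun i j => coeff i (PowerSeries.mk p ^ m) * coeff j (PowerSeries.mk p))]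
    simp [convPow, ih]

open PowerSeries in
theorem coeff_eq_tsum_convPow {p : ℕ → ℝ} (hp0 : p 0 = 0) {U : ℝ⟦X⟧}
    (hU : U * (1 - PowerSeries.mk p) = 1) {n : ℕ} (hn : 1 ≤ n) :
    ∑' m, convPow p (m + 1) n = coeff n U := by
  have hX : X ∣ PowerSeries.mk p := X_dvd_iff.2 (by simpa using hp0)
  have hzero {N : ℕ} (hN : n < N) : coeff n (PowerSeries.mk p ^ N) = 0 :=
    X_pow_dvd_iff.1 (pow_dvd_pow_of_dvd hX N) n hN
  have hgeom : U = ∑ m ∈ Finset.range (n + 1), PowerSeries.mk p ^ m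
      + U * PowerSeries.mk p ^ (n + 1) := by
    have := congrArg (U * ·) (mul_neg_geom_sum (PowerSeries.mk p) (n + 1))
    simp only [← mul_assoc, hU, one_mul] at this
    rw [this]
    ring
  have hlast : coeff n (U * PowerSeries.mk p ^ (n + 1)) = 0 :=
    X_pow_dvd_iff.1 ((pow_dvd_pow_of_dvd hX (n + 1)).mul_left U) n n.lt_succ_self
  rw [hgeom, map_add, hlast, add_zero, map_sum, Finset.sum_range_succ', pow_zero, coeff_one,
    if_neg (by lia), add_zero, tsum_eq_sum (s := Finset.range n)]
  · simp_rw [convPow_eq_coeff]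
  · intro m hm
    rw [convPow_eq_coeff]
    exact hzero (by simpa using hm)

/-- The generating function of an aperiodic distribution takes the value `1` in the closed unit
disc only at `1`. -/
theorem eq_one_of_hasSum_mul_pow {p : ℕ → ℝ} (hp : HasSum p 1) (hp0 : ∀ n, 0 ≤ p n)
    (haper : ∀ N : ℕ, 2 ≤ N → ∃ n, 0 < p n ∧ ¬ N ∣ n) {z : ℂ} (hz : ‖z‖ ≤ 1)
    (h : HasSum (fun n => (p n : ℂ) * z ^ n) 1) : z = 1 := by
  have hnorm (n : ℕ) : ‖z ^ n‖ ≤ 1 := by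
    rw [norm_pow]
    exact pow_le_one₀ (norm_nonneg z) hz
  have hre : HasSum (fun n => p n * (1 - (z ^ n).re)) 0 := by
    have := hp.sub (Complex.hasSum_re h)
    simpa [mul_sub] using this
  have hnonneg (n : ℕ) : 0 ≤ p n * (1 - (z ^ n).re) :=
    mul_nonneg (hp0 n) (sub_nonneg.2 ((Complex.re_le_norm _).trans (hnorm n)))
  have hpow {n : ℕ} (hn : 0 < p n) : z ^ n = 1 := by
    have h1 : p n * (1 - (z ^ n).re) = 0 :=
      congrFun ((hasSum_zero_iff_of_nonneg hnonneg).1 hre) n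
    have h2 : (z ^ n).re = 1 := by
      rcases mul_eq_zero.1 h1 with h | h <;> linarith
    have h3 : (z ^ n).re ^ 2 + (z ^ n).im ^ 2 ≤ 1 := by
      rw [sq, sq, ← Complex.normSq_apply, ← Complex.sq_norm]
      exact pow_le_one₀ (norm_nonneg _) (hnorm n)
    have h4 : (z ^ n).im = 0 := by
      rw [h2] at h3
      nlinarith [sq_nonneg (z ^ n).im]
    exact Complex.ext h2 h4
  have hlt : orderOf z < 2 := by
    by_contra! hN
    obtain ⟨n, hn, hdvd⟩ := haper _ hN
    exact hdvd (orderOf_dvd_of_pow_eq_one (hpow hn))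
  have hne : orderOf z ≠ 0 := by
    intro h0
    obtain ⟨n, hn, hdvd⟩ := haper 2 le_rfl
    have := orderOf_dvd_of_pow_eq_one (hpow hn)
    rw [h0, zero_dvd_iff] at this
    exact hdvd (this ▸ dvd_zero 2)
  exact orderOf_eq_one_iff.1 (by lia)

open PowerSeries in
/-- For an aperiodic distribution with geometric tails, the inverse of the generating function
of the tails has geometrically decaying coefficients. -/
theorem exists_geometric_bound_coeff_tailProb_inv {p : ℕ → ℝ} (hp0 : p 0 = 0)
    (hpnonneg : ∀ n, 0 ≤ p n) (hp : HasSum p 1)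
    (haper : ∀ N : ℕ, 2 ≤ N → ∃ n, 0 < p n ∧ ¬ N ∣ n)
    {C r : ℝ} (hr0 : 0 < r) (hr1 : r < 1) (hq : ∀ n, tailProb p n ≤ C * r ^ n) :
    ∃ K s : ℝ, 0 < s ∧ s < 1 ∧ ∀ n, |coeff n (PowerSeries.mk (tailProb p))⁻¹| ≤ K * s ^ n := by
  have hq0 := tailProb_nonneg hp hpnonneg
  have hqsum := summable_of_le_geometric hq0 hr0.le hr1 hq
  have hqsum_pos : 0 < ∑' n, tailProb p n :=
    hqsum.tsum_pos hq0 0 (by simp [tailProb, hp0])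
  set Q := PowerSeries.mk (tailProb p) with hQ
  have hAQ : Q⁻¹ * Q = 1 :=
    PowerSeries.inv_mul_cancel Q (by simp [hQ, tailProb, hp0])
  have hmap : PowerSeries.map Complex.ofRealHom Q⁻¹ * PowerSeries.map Complex.ofRealHom Q = 1 := by
    rw [← map_mul, hAQ, map_one]
  have hsummable {z : ℂ} (hz : ‖z‖ ≤ 1) : Summable fun n => ‖(tailProb p n : ℂ) * z ^ n‖ := by
    refine .of_nonneg_of_le (fun n => norm_nonneg _) (fun n => ?_) hqsum
    rw [norm_mul, norm_pow, Complex.norm_of_nonneg (hq0 n)]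
    exact mul_le_of_le_one_right (hq0 n) (pow_le_one₀ (norm_nonneg z) hz)
  obtain ⟨K, s, hs0, hs1, hK⟩ := exists_geometric_bound_of_mul_eq_one hmap hr0 hr1
    (fun n => by simpa [hQ, abs_of_nonneg (hq0 n)] using hq n) (fun z hz h => by
      have hmul : PowerSeries.map Complex.ofRealHom Q * (1 - X) =
          1 - PowerSeries.map Complex.ofRealHom (PowerSeries.mk p) := by
        have := congrArg (PowerSeries.map Complex.ofRealHom) (mk_tailProb_mul hp0)
        simpa only [map_mul, map_sub, map_one, map_X] using this
      have hX : Summable fun n => ‖coeff n (1 - X : ℂ⟦X⟧) * z ^ n‖ :=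
        summable_of_ne_finset_zero (s := Finset.range 2) fun n hn => by
          simp only [Finset.mem_range, not_lt] at hn
          rw [map_sub, coeff_one, coeff_X, if_neg (by lia), if_neg (by lia)]
          simp
      have h1 := hasSum_coeff_mul (PowerSeries.map Complex.ofRealHom Q) (1 - X) z
        (by simpa [hQ] using hsummable hz) hX
      rw [h, zero_mul, hmul] at h1
      have h2 := (hasSum_coeff_one z).sub h1
      simp only [map_sub, coeff_map, coeff_mk, sub_zero, sub_mul, sub_sub_cancel,
        Complex.ofRealHom_eq_coe] at h2
      have hz1 := eq_one_of_hasSum_mul_pow hp hpnonneg haper hz h2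
      simp only [hz1, hQ, coeff_map, coeff_mk, one_pow, mul_one, Complex.ofRealHom_eq_coe] at h
      rw [← Complex.ofReal_tsum] at h
      exact hqsum_pos.ne' (by exact_mod_cast h))
  exact ⟨K, s, hs0, hs1, fun n => by simpa using hK n⟩

/-- Lemma 4.2 (renewal theorem with exponentially controlled rate): if `p` is an
aperiodic probability distribution on `ℤ_{>0}` of class `𝓔` (exponential tail),
then the renewal sequence `u n = ∑_{m≥1} p^{*m}(n)` satisfies
`|u n - μ⁻¹| ≤ c₁ e^{-c₂ n}` for all `n ≥ 1`, where `μ = ∑ n·p n` is the mean. -/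
theorem renewal_theorem_exponential_rate (p : ℕ → ℝ)
    (hp0 : p 0 = 0) (hpnonneg : ∀ n, 0 ≤ p n) (hple : ∀ n, p n ≤ 1)
    (hpsum : ∑' n, p n = 1)
    (r : ℝ) (hr : r ∈ Set.Ioo (0 : ℝ) 1) (N₀ : ℕ)
    (htail : ∀ n ≥ N₀, p n ≤ r ^ n)
    (haper : ∀ N : ℕ, 2 ≤ N → ∃ n, 0 < p n ∧ ¬ N ∣ n) :
    ∃ c₁ > (0 : ℝ), ∃ c₂ > (0 : ℝ), ∀ n : ℕ, 1 ≤ n →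
      |(∑' m : ℕ, convPow p (m + 1) n) - (∑' n : ℕ, (n : ℝ) * p n)⁻¹| ≤
        c₁ * Real.exp (-c₂ * n) := by
  obtain ⟨hr0, hr1⟩ := hr
  obtain ⟨C, -, hC⟩ := exists_le_geometric_of_eventually hr0 htail
  have hp : HasSum p 1 := hpsum ▸ (summable_of_le_geometric hpnonneg hr0.le hr1 hC).hasSum
  have hq0 := tailProb_nonneg hp hpnonneg
  have hq := tailProb_le_geometric hp hr0.le hr1 hC
  have hqsum := summable_of_le_geometric hq0 hr0.le hr1 hq
  have hmean := tsum_tailProb_eq_mean hp hpnonneg hr0.le hr1 hq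
  obtain ⟨K, s, hs0, hs1, hA⟩ :=
    exists_geometric_bound_coeff_tailProb_inv hp0 hpnonneg hp haper hr0 hr1 hq
  set Q := PowerSeries.mk (tailProb p) with hQ
  set A := Q⁻¹
  have hAQ : A * Q = 1 :=
    PowerSeries.inv_mul_cancel Q (by simp [hQ, tailProb, hp0])
  have hAsum : Summable fun n => ‖PowerSeries.coeff n A‖ :=
    summable_of_le_geometric (fun n => norm_nonneg _) hs0.le hs1 hA
  have hAtsum : ∑' n, PowerSeries.coeff n A = (∑' n : ℕ, (n : ℝ) * p n)⁻¹ := by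
    have := hasSum_coeff_mul A Q 1 (by simpa using hAsum) (by simpa [hQ] using hqsum.norm)
    rw [hAQ] at this
    rw [← hmean]
    refine eq_inv_of_mul_eq_one_left ?_
    simpa [hQ] using this.unique (hasSum_coeff_one 1)
  have hU : A * PowerSeries.mk 1 * (1 - PowerSeries.mk p) = 1 := by
    rw [← mk_tailProb_mul hp0, ← hQ]
    calc _ = (A * Q) * (PowerSeries.mk 1 * (1 - PowerSeries.X)) := by ring
      _ = 1 := by rw [hAQ, PowerSeries.mk_one_mul_one_sub_eq_one, one_mul]
  have hcoeff (n : ℕ) :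
      PowerSeries.coeff n (A * PowerSeries.mk 1) =
        ∑ k ∈ Finset.range (n + 1), PowerSeries.coeff k A := by
    rw [PowerSeries.coeff_mul, Finset.Nat.sum_antidiagonal_eq_sum_range_succ
      (fun i j => PowerSeries.coeff i A * PowerSeries.coeff j (PowerSeries.mk 1))]
    simp
  have hdist := dist_le_of_le_geometric_of_tendsto s K hs1
    (fun n => by simpa [Finset.sum_range_succ, dist_eq_norm] using hA n)
    hAsum.of_norm.hasSum.tendsto_sum_nat
  have hK0 : 0 ≤ K := by simpa using (abs_nonneg _).trans (hA 0)
  have h1s : 0 < 1 - s := sub_pos.2 hs1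
  refine ⟨K * s / (1 - s) + 1, by positivity, -Real.log s, neg_pos.2 (Real.log_neg hs0 hs1),
    fun n hn => ?_⟩
  rw [coeff_eq_tsum_convPow hp0 hU hn, hcoeff, ← hAtsum, neg_neg, mul_comm (Real.log s),
    Real.exp_nat_mul, Real.exp_log hs0]
  calc _ ≤ K * s ^ (n + 1) / (1 - s) := hdist (n + 1)
    _ = K * s / (1 - s) * s ^ n := by ring
    _ ≤ _ := by gcongr; linarith
end

section
/- Let π : ℤ_{>0} → [0,1] satisfy ∑_{i≥1} π_i = 1 and π_i ≤ r^i for all i ≥ N₀, for some r ∈ (0,1) and N₀. Let u : ℤ_{>0} → [0,∞) and μ > 0 satisfy |u_n − μ^{-1}| ≤ c₁ e^{−c₂ n} for all n ≥ 1, with c₁, c₂ > 0. Then there exist constants C, c > 0 such that for every j ≥ 1, |∑_{i=1}^{j-1} π_i u_{j-i} − μ^{-1}| ≤ C e^{−c j}. -/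
open scoped BigOperators

/-- A sequence bounded by `1` with terms eventually below `r ^ i`, where `r ≤ exp (-a)`, is
bounded by a constant multiple of `exp (-a * i)`. -/
theorem le_exp_mul_exp_of_eventually_le_pow {p : ℕ → ℝ} (hp : ∀ i, p i ≤ 1) {r a : ℝ}
    (hr : 0 ≤ r) (ha : 0 ≤ a) (hra : r ≤ Real.exp (-a)) {N : ℕ} (htail : ∀ i ≥ N, p i ≤ r ^ i)
    (i : ℕ) : p i ≤ Real.exp (a * N) * Real.exp (-a * i) := by
  rcases le_total N i with h | h
  · calc p i ≤ r ^ i := htail i h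
      _ ≤ Real.exp (-a) ^ i := by gcongr
      _ = Real.exp (-a * i) := by rw [← Real.exp_nat_mul, mul_comm]
      _ ≤ Real.exp (a * N) * Real.exp (-a * i) :=
        le_mul_of_one_le_left (Real.exp_pos _).le (Real.one_le_exp (by positivity))
  · rw [← Real.exp_add]
    refine (hp i).trans (Real.one_le_exp ?_)
    have : (i : ℝ) ≤ N := by exact_mod_cast h
    nlinarith

/-- The estimate in the proof of Theorem 4.1: if the delay distribution `π` on
`ℤ_{>0}` has an exponential tail and the renewal sequence `u` converges to `μ⁻¹`
exponentially fast, then `(πQ)_j = ∑_{i=1}^{j-1} π_i u_{j-i}` converges to `μ⁻¹`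
exponentially fast as well. -/
theorem delayed_renewal_exponential_rate (π : ℕ → ℝ)
    (hπ0 : π 0 = 0) (hπnonneg : ∀ i, 0 ≤ π i) (hπle : ∀ i, π i ≤ 1)
    (hπsum : ∑' i, π i = 1)
    (r : ℝ) (hr : r ∈ Set.Ioo (0 : ℝ) 1) (N₀ : ℕ)
    (hπtail : ∀ i ≥ N₀, π i ≤ r ^ i)
    (u : ℕ → ℝ) (hu : ∀ n, 0 ≤ u n)
    (μ : ℝ) (hμ : 0 < μ)
    (c₁ c₂ : ℝ) (hc₁ : 0 < c₁) (hc₂ : 0 < c₂)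
    (hrenewal : ∀ n : ℕ, 1 ≤ n → |u n - μ⁻¹| ≤ c₁ * Real.exp (-c₂ * n)) :
    ∃ C > (0 : ℝ), ∃ c > (0 : ℝ), ∀ j : ℕ, 1 ≤ j →
      |(∑ i ∈ Finset.Ico 1 j, π i * u (j - i)) - μ⁻¹| ≤ C * Real.exp (-c * j) := by
  obtain ⟨hr0, hr1⟩ := hr
  have hlog : Real.log r < 0 := Real.log_neg hr0 hr1
  obtain ⟨c, hc, hcc, hcr⟩ : ∃ c > 0, c ≤ c₂ ∧ c ≤ -Real.log r / 2 :=
    ⟨min c₂ (-Real.log r / 2), lt_min hc₂ (by linarith), min_le_left _ _, min_le_right _ _⟩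
  have hrexp : r ≤ Real.exp (-(2 * c)) :=
    (Real.log_le_iff_le_exp hr0).1 (by linarith)
  set K := Real.exp (2 * c * N₀)
  set t := Real.exp (-c)
  have hK : 0 < K := Real.exp_pos _
  have ht0 : 0 < t := Real.exp_pos _
  have ht1 : t < 1 := Real.exp_lt_one_iff.2 (by linarith)
  have ht (n : ℕ) : Real.exp (-c * n) = t ^ n := by rw [← Real.exp_nat_mul, mul_comm]
  have hπK (i : ℕ) : π i ≤ K * (t ^ i * t ^ i) := by
    have h := le_exp_mul_exp_of_eventually_le_pow hπle hr0.le (by linarith) hrexp hπtail i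
    rwa [show -(2 * c) * (i : ℝ) = -c * i + -c * i by ring, Real.exp_add, ht] at h
  have hut (n : ℕ) (hn : 1 ≤ n) : |u n - μ⁻¹| ≤ c₁ * t ^ n := by
    refine (hrenewal n hn).trans ?_
    rw [← ht]
    gcongr
  have hπ : HasSum π 1 := by
    have hs : Summable π := by
      by_contra h
      rw [tsum_eq_zero_of_not_summable h] at hπsum
      exact zero_ne_one hπsum
    exact hπsum ▸ hs.hasSum
  have hm : 0 < μ⁻¹ := inv_pos.2 hμ
  have h1t : 0 < 1 - t := by linarith
  refine ⟨K * (c₁ + μ⁻¹) * (1 - t)⁻¹, by positivity, c, hc, fun j _ => ?_⟩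
  let f : ℕ → ℝ := fun i => if i ∈ Finset.Ico 1 j then π i * u (j - i) else 0
  have hf : HasSum f (∑ i ∈ Finset.Ico 1 j, π i * u (j - i)) := by
    have h : HasSum f (∑ i ∈ Finset.Ico 1 j, f i) :=
      hasSum_sum_of_ne_finset_zero fun i hi => if_neg hi
    rwa [Finset.sum_congr rfl fun i hi => if_pos hi] at h
  have hdiff := hf.sub (hπ.mul_right μ⁻¹)
  rw [one_mul] at hdiff
  have hgeom := (hasSum_geometric_of_lt_one ht0.le ht1).mul_left (K * (c₁ + μ⁻¹) * t ^ j)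
  have hbound (i : ℕ) : ‖f i - π i * μ⁻¹‖ ≤ K * (c₁ + μ⁻¹) * t ^ j * t ^ i := by
    by_cases hi : i ∈ Finset.Ico 1 j
    · have hij := (Finset.mem_Ico.1 hi).2
      have hpow : t ^ i * t ^ (j - i) = t ^ j := by rw [← pow_add]; congr 1; omega
      calc ‖f i - π i * μ⁻¹‖ = π i * |u (j - i) - μ⁻¹| := by
            rw [show f i = π i * u (j - i) from if_pos hi, ← mul_sub, Real.norm_eq_abs, abs_mul,
              abs_of_nonneg (hπnonneg i)]
        _ ≤ K * (t ^ i * t ^ i) * (c₁ * t ^ (j - i)) :=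
          mul_le_mul (hπK i) (hut _ (by omega)) (abs_nonneg _) (by positivity)
        _ = K * c₁ * t ^ j * t ^ i := by rw [← hpow]; ring
        _ ≤ K * (c₁ + μ⁻¹) * t ^ j * t ^ i := by gcongr; linarith
    · rw [show f i = 0 from if_neg hi, zero_sub, norm_neg, Real.norm_eq_abs,
        abs_of_nonneg (mul_nonneg (hπnonneg i) hm.le)]
      rcases Nat.eq_zero_or_pos i with rfl | hi0
      · rw [hπ0, zero_mul]
        positivity
      · have hij : j ≤ i := by
          by_contra h
          exact hi (Finset.mem_Ico.2 ⟨hi0, not_le.1 h⟩)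
        calc π i * μ⁻¹ ≤ K * (t ^ j * t ^ i) * μ⁻¹ := by
              refine mul_le_mul_of_nonneg_right ((hπK i).trans ?_) hm.le
              have := pow_le_pow_of_le_one ht0.le ht1.le hij
              gcongr
          _ = K * μ⁻¹ * t ^ j * t ^ i := by ring
          _ ≤ K * (c₁ + μ⁻¹) * t ^ j * t ^ i := by gcongr; linarith
  have h := tsum_of_norm_bounded hgeom hbound
  rw [hdiff.tsum_eq, Real.norm_eq_abs] at h
  rw [ht]
  linarith
end

section
/- Let π, p : ℤ_{>0} → [0,1] be probability distributions, both of class 𝓔 (there exists r ∈ (0,1) with π_n ≤ r^n and p_n ≤ r^n for all large n), with p aperiodic (for every N ≥ 2 there exists n with p_n > 0 and N ∤ n). Let u_n = ∑_{m=1}^∞ p^{*m}(n), set Q_{ij} = u_{j−i} for i < j and Q_{ij} = 0 for i ≥ j, and define K_{ij} = π_i + ∑_{i'=1}^{i-1} π_{i'} u_{i−i'} − Q_{ji} for i, j ∈ ℤ_{>0}. Then there exist α > 0 and C > 0 such that the matrix K̃_{ij} = e^{α(i−j)} K_{ij} defines a bounded operator on ℓ²(ℤ_{>0}): for every finitely supported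 v : ℤ_{>0} → ℝ, ∑_i (∑_j K̃_{ij} v_j)² ≤ C² ∑_j v_j². Moreover K̃ has the same principal minors as K, so it is also a correlation kernel for the delayed renewal process. -/
open scoped BigOperators

/-- The renewal sequence `u n = ∑_{m≥1} p^{*m}(n)` of `p`. -/
noncomputable def renewalSeq (p : ℕ → ℝ) (n : ℕ) : ℝ :=
  ∑' m : ℕ, convPow p (m + 1) n

/-- The matrix `Q` of the delayed renewal process: `Q i j = u (j - i)` for `i < j`
and `Q i j = 0` otherwise. -/
noncomputable def Qren (p : ℕ → ℝ) (i j : ℕ) : ℝ :=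
  if i < j then renewalSeq p (j - i) else 0

/-- The correlation kernel `K i j = π i + ∑_{i'=1}^{i-1} π i' · u (i - i') - Q j i`
of the delayed renewal process (Theorem 1.1 applied to the renewal chain). -/
noncomputable def Kren (π p : ℕ → ℝ) (i j : ℕ) : ℝ :=
  π i + (∑ i' ∈ Finset.Ico 1 i, π i' * renewalSeq p (i - i')) - Qren p j i

open Filter Topology in
/-- A power series with geometrically decaying coefficients and no zero in the closed unit disc has
a reciprocal whose coefficients decay geometrically. -/
theorem exists_inverse_series_of_geometric_decay (a : ℕ → ℂ) {A r : ℝ} (hr0 : 0 < r) (hr1 : r < 1)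
    (ha : ∀ n, ‖a n‖ ≤ A * r ^ n) (hne : ∀ z : ℂ, ‖z‖ ≤ 1 → ∑' n, z ^ n * a n ≠ 0) :
    ∃ (s : ℕ → ℂ) (ρ C : ℝ), 0 < ρ ∧ ρ < 1 ∧ (∀ n, ‖s n‖ ≤ C * ρ ^ n) ∧
      PowerSeries.mk a * PowerSeries.mk s = 1 := by
  obtain ⟨R, hR1, hrR⟩ : ∃ R : ℝ, 1 < R ∧ r * R < 1 := by
    refine ⟨2 / (1 + r), ?_, ?_⟩
    · rw [lt_div_iff₀ (by linarith)]; linarith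
    · rw [← mul_div_assoc, div_lt_one (by linarith)]; linarith
  have hA : 0 ≤ A := by simpa using (norm_nonneg _).trans (ha 0)
  have hbound : ∀ n (w : ℂ), w ∈ Metric.ball (0 : ℂ) R → ‖w ^ n * a n‖ ≤ A * (r * R) ^ n := by
    intro n w hw
    have hw' : ‖w‖ ≤ R := (mem_ball_zero_iff.1 hw).le
    rw [norm_mul, norm_pow, mul_pow]
    calc ‖w‖ ^ n * ‖a n‖ ≤ R ^ n * (A * r ^ n) := by
          gcongr
          exact ha n
      _ = A * (r ^ n * R ^ n) := by ring
  have hsum : Summable fun n : ℕ => A * (r * R) ^ n :=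
    (summable_geometric_of_lt_one (by positivity) hrR).mul_left A
  set f : ℂ → ℂ := fun z => ∑' n, z ^ n * a n
  have hdiff : DifferentiableOn ℂ f (Metric.ball 0 R) :=
    Complex.differentiableOn_tsum_of_summable_norm hsum (fun n => by fun_prop)
      Metric.isOpen_ball hbound
  have hopen : IsOpen (Metric.ball (0 : ℂ) R ∩ f ⁻¹' {0}ᶜ) :=
    hdiff.continuousOn.isOpen_inter_preimage Metric.isOpen_ball isOpen_compl_singleton
  obtain ⟨δ, hδ, hsub⟩ := (isCompact_closedBall (0 : ℂ) 1).exists_cthickening_subset_open hopen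
    (fun z hz => by
      rw [mem_closedBall_zero_iff] at hz
      exact ⟨mem_ball_zero_iff.2 (by linarith), hne z hz⟩)
  rw [cthickening_closedBall hδ.le zero_le_one] at hsub
  have hinv : DifferentiableOn ℂ (fun z => (f z)⁻¹) (Metric.closedBall 0 (δ + 1)) :=
    (hdiff.mono fun z hz => (hsub hz).1).inv fun z hz => (hsub hz).2
  let R' : NNReal := ⟨δ + 1, by positivity⟩
  have hR' : 0 < R' := by
    rw [← NNReal.coe_pos]; change 0 < δ + 1; positivity
  have hps := DifferentiableOn.hasFPowerSeriesOnBall (R := R') hinv hR'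
  set q := cauchyPowerSeries (fun z => (f z)⁻¹) 0 R'
  let R₂ : NNReal := ⟨δ / 2 + 1, by positivity⟩
  have hR₂ : (R₂ : ENNReal) < q.radius := by
    refine lt_of_lt_of_le ?_ hps.r_le
    rw [ENNReal.coe_lt_coe, ← NNReal.coe_lt_coe]
    change δ / 2 + 1 < δ + 1
    linarith
  obtain ⟨C, hC, hqC⟩ := q.norm_mul_pow_le_of_lt_radius hR₂
  have hdecay : ∀ n, ‖q.coeff n‖ ≤ C * ((δ / 2 + 1)⁻¹) ^ n := by
    intro n
    have h := hqC n
    rw [FormalMultilinearSeries.norm_apply_eq_norm_coef] at h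
    rw [inv_pow, ← div_eq_mul_inv, le_div_iff₀ (by positivity)]
    exact h
  have hρ1 : (δ / 2 + 1)⁻¹ < 1 := inv_lt_one_of_one_lt₀ (by linarith)
  refine ⟨q.coeff, (δ / 2 + 1)⁻¹, C, by positivity, hρ1, hdecay, ?_⟩
  have hprod : HasFPowerSeriesAt (fun _ : ℂ => (1 : ℂ)) (FormalMultilinearSeries.ofScalars ℂ
      fun n => PowerSeries.coeff n (PowerSeries.mk a * PowerSeries.mk q.coeff)) 0 := by
    rw [hasFPowerSeriesAt_iff]
    have h2 := hasFPowerSeriesAt_iff.1 hps.hasFPowerSeriesAt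
    filter_upwards [h2, Metric.ball_mem_nhds (0 : ℂ) one_pos] with z hz2 hz
    rw [zero_add] at hz2
    have hz1 : ‖z‖ < 1 := mem_ball_zero_iff.1 hz
    have hs1 : Summable fun n => ‖z ^ n * a n‖ :=
      Summable.of_nonneg_of_le (fun _ => norm_nonneg _)
        (fun n => hbound n z (mem_ball_zero_iff.2 (by linarith))) hsum
    have hs2 : Summable fun n => ‖z ^ n * q.coeff n‖ := by
      refine Summable.of_nonneg_of_le (fun _ => norm_nonneg _) (fun n => ?_)
        ((summable_geometric_of_lt_one (by positivity) hρ1).mul_left C)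
      rw [norm_mul, norm_pow]
      exact (mul_le_of_le_one_left (norm_nonneg _)
        (pow_le_one₀ (norm_nonneg _) hz1.le)).trans (hdecay n)
    have hmul := tsum_mul_tsum_eq_tsum_sum_antidiagonal_of_summable_norm hs1 hs2
    have hsm := (summable_norm_sum_mul_antidiagonal_of_summable_norm hs1 hs2).of_norm.hasSum
    have hq2 : ∑' n, z ^ n * q.coeff n = (f z)⁻¹ := hz2.tsum_eq
    rw [← hmul, hq2] at hsm
    change HasSum _ (f z * (f z)⁻¹) at hsm
    rw [mul_inv_cancel₀ (hne z hz1.le)] at hsm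
    refine (iff_of_eq (congrArg (HasSum · _) (funext fun n => ?_))).2 hsm
    rw [FormalMultilinearSeries.coeff_ofScalars, PowerSeries.coeff_mul, smul_eq_mul,
      Finset.mul_sum]
    refine Finset.sum_congr rfl fun kl hkl => ?_
    rw [PowerSeries.coeff_mk, PowerSeries.coeff_mk,
      ← Finset.HasAntidiagonal.mem_antidiagonal.1 hkl, pow_add]
    ring
  have hone : HasFPowerSeriesAt (fun _ : ℂ => (1 : ℂ)) (FormalMultilinearSeries.ofScalars ℂ
      fun n => PowerSeries.coeff n (1 : PowerSeries ℂ)) 0 := by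
    rw [hasFPowerSeriesAt_iff]
    refine Eventually.of_forall fun z => ?_
    refine (iff_of_eq (congrArg (HasSum · _) (funext fun n => ?_))).2 (hasSum_ite_eq 0 (1 : ℂ))
    rw [FormalMultilinearSeries.coeff_ofScalars, PowerSeries.coeff_one]
    split_ifs with h <;> simp [h]
  ext n
  have h := congrArg (fun p => FormalMultilinearSeries.coeff p n)
    (hprod.eq_formalMultilinearSeries hone)
  simpa only [FormalMultilinearSeries.coeff_ofScalars] using h

/-- The renewal sequence with the initial value `1` at `0`. -/
noncomputable def fullRenewal (p : ℕ → ℝ) (n : ℕ) : ℝ :=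
  if n = 0 then 1 else renewalSeq p n

theorem coeff_mk_pow_eq_convPow (p : ℕ → ℝ) (m n : ℕ) :
    PowerSeries.coeff n (PowerSeries.mk p ^ m) = convPow p m n := by
  induction m generalizing n with
  | zero => simp [convPow, PowerSeries.coeff_one]
  | succ m ih =>
    rw [pow_succ, PowerSeries.coeff_mul, Finset.Nat.sum_antidiagonal_eq_sum_range_succ_mk]
    simp only [ih, PowerSeries.coeff_mk, convPow]

theorem convPow_eq_zero_of_lt {p : ℕ → ℝ} (hp0 : p 0 = 0) {m n : ℕ} (h : n < m) :
    convPow p m n = 0 := by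
  rw [← coeff_mk_pow_eq_convPow]
  refine PowerSeries.X_pow_dvd_iff.1 (pow_dvd_pow_of_dvd ?_ m) n h
  rw [PowerSeries.X_dvd_iff, ← PowerSeries.coeff_zero_eq_constantCoeff_apply,
    PowerSeries.coeff_mk, hp0]

theorem fullRenewal_eq_sum {p : ℕ → ℝ} (hp0 : p 0 = 0) {n N : ℕ} (h : n < N) :
    fullRenewal p n = ∑ m ∈ Finset.range N, convPow p m n := by
  obtain ⟨N, rfl⟩ : ∃ k, N = k + 1 := ⟨N - 1, by omega⟩
  have hu : renewalSeq p n = ∑ m ∈ Finset.range N, convPow p (m + 1) n :=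
    tsum_eq_sum fun m hm => convPow_eq_zero_of_lt hp0 (by simp at hm; omega)
  rw [Finset.sum_range_succ', ← hu, fullRenewal]
  split_ifs with hn
  · subst hn
    rw [hu, Finset.sum_eq_zero fun m _ => convPow_eq_zero_of_lt hp0 m.succ_pos]
    simp [convPow]
  · simp [convPow, hn]

theorem mk_fullRenewal_mul {p : ℕ → ℝ} (hp0 : p 0 = 0) :
    PowerSeries.mk (fullRenewal p) * (1 - PowerSeries.mk p) = 1 := by
  ext n
  have h : PowerSeries.coeff n (PowerSeries.mk (fullRenewal p) * (1 - PowerSeries.mk p)) =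
      PowerSeries.coeff n ((∑ m ∈ Finset.range (n + 1), PowerSeries.mk p ^ m) *
        (1 - PowerSeries.mk p)) := by
    rw [PowerSeries.coeff_mul, PowerSeries.coeff_mul]
    refine Finset.sum_congr rfl fun kl hkl => ?_
    have hk : kl.1 < n + 1 := by have := Finset.HasAntidiagonal.mem_antidiagonal.1 hkl; omega
    rw [PowerSeries.coeff_mk, fullRenewal_eq_sum hp0 hk, map_sum]
    simp only [coeff_mk_pow_eq_convPow]
  rw [h, geom_sum_mul_neg, map_sub, coeff_mk_pow_eq_convPow,
    convPow_eq_zero_of_lt hp0 n.lt_succ_self, sub_zero]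

/-- The tail `∑_{k > n} p k` of a probability distribution. -/
def tailSeq (p : ℕ → ℝ) (n : ℕ) : ℝ := 1 - ∑ k ∈ Finset.range (n + 1), p k

theorem tailSeq_zero {p : ℕ → ℝ} (hp0 : p 0 = 0) : tailSeq p 0 = 1 := by
  simp [tailSeq, hp0]

theorem tailSeq_succ (p : ℕ → ℝ) (n : ℕ) : tailSeq p (n + 1) = tailSeq p n - p (n + 1) := by
  rw [tailSeq, tailSeq, Finset.sum_range_succ _ (n + 1)]
  ring

theorem one_sub_mk_eq {p : ℕ → ℝ} (hp0 : p 0 = 0) :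
    1 - PowerSeries.mk p = (1 - PowerSeries.X) * PowerSeries.mk (tailSeq p) := by
  ext n
  rw [sub_mul, one_mul, mul_comm, map_sub, map_sub, PowerSeries.coeff_mk, PowerSeries.coeff_mk,
    PowerSeries.coeff_one]
  cases n with
  | zero => simp [tailSeq_zero hp0, hp0]
  | succ n =>
    rw [PowerSeries.coeff_succ_mul_X, PowerSeries.coeff_mk, tailSeq_succ]
    simp

/-- A distribution bounded by a geometric sequence from some point on is bounded by a multiple of
it everywhere, and so are its tails. -/
theorem exists_geometric_bound {p : ℕ → ℝ} (hp : ∀ n, 0 ≤ p n) (hple : ∀ n, p n ≤ 1)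
    (hsum : ∑' n, p n = 1) {r : ℝ} (hr0 : 0 < r) (hr1 : r < 1) {N₀ : ℕ}
    (htail : ∀ n ≥ N₀, p n ≤ r ^ n) :
    ∃ A > 0, (∀ n, p n ≤ A * r ^ n) ∧ ∀ n, 0 ≤ tailSeq p n ∧ tailSeq p n ≤ A * r ^ n := by
  have hs : Summable p := by
    by_contra h
    rw [tsum_eq_zero_of_not_summable h] at hsum
    exact zero_ne_one hsum
  have hB1 : 1 ≤ (r ^ N₀)⁻¹ := (one_le_inv₀ (by positivity)).2 (pow_le_one₀ hr0.le hr1.le)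
  have hB : ∀ n, p n ≤ (r ^ N₀)⁻¹ * r ^ n := by
    intro n
    rcases le_total N₀ n with h | h
    · exact (htail n h).trans (le_mul_of_one_le_left (by positivity) hB1)
    · refine (hple n).trans ?_
      rw [inv_mul_eq_div, one_le_div (by positivity)]
      exact pow_le_pow_of_le_one hr0.le hr1.le h
  have h1r : 0 < 1 - r := by linarith
  have hle : (r ^ N₀)⁻¹ ≤ (r ^ N₀)⁻¹ * (1 - r)⁻¹ :=
    le_mul_of_one_le_right (by positivity) ((one_le_inv₀ h1r).2 (by linarith))
  refine ⟨(r ^ N₀)⁻¹ * (1 - r)⁻¹, by positivity,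
    fun n => (hB n).trans (mul_le_mul_of_nonneg_right hle (by positivity)), fun n => ?_⟩
  have ht : tailSeq p n = ∑' k, p (k + (n + 1)) := by
    rw [tailSeq, ← hsum, ← hs.sum_add_tsum_nat_add (n + 1)]
    ring
  rw [ht]
  refine ⟨tsum_nonneg fun _ => hp _, ?_⟩
  have hg : HasSum (fun k : ℕ => (r ^ N₀)⁻¹ * r ^ n * r ^ k) ((r ^ N₀)⁻¹ * r ^ n * (1 - r)⁻¹) :=
    (hasSum_geometric_of_lt_one hr0.le hr1).mul_left _
  calc ∑' k, p (k + (n + 1)) ≤ ∑' k, (r ^ N₀)⁻¹ * r ^ n * r ^ k := by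
        refine ((summable_nat_add_iff (n + 1)).2 hs).tsum_le_tsum (fun k => ?_) hg.summable
        refine (hB _).trans ?_
        rw [mul_assoc, ← pow_add]
        exact mul_le_mul_of_nonneg_left
          (pow_le_pow_of_le_one hr0.le hr1.le (by omega)) (by positivity)
    _ = (r ^ N₀)⁻¹ * (1 - r)⁻¹ * r ^ n := by rw [hg.tsum_eq]; ring

/-- The generating function of an aperiodic distribution equals `1` in the closed unit disc only
at the point `1`. -/
theorem eq_one_of_tsum_pow_mul_eq_one {p : ℕ → ℝ} (hp0 : p 0 = 0) (hp : ∀ n, 0 ≤ p n)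
    (hsum : HasSum p 1) (haper : ∀ N : ℕ, 2 ≤ N → ∃ n, 0 < p n ∧ ¬ N ∣ n) {z : ℂ}
    (hz : ‖z‖ ≤ 1) (h : HasSum (fun n => z ^ n * (p n : ℂ)) 1) : z = 1 := by
  have hre : HasSum (fun n => (z ^ n).re * p n) 1 := by
    simpa using Complex.hasSum_re h
  have hnorm : ∀ n, ‖z ^ n‖ ≤ 1 := fun n => by
    rw [norm_pow]; exact pow_le_one₀ (norm_nonneg _) hz
  have hre1 : ∀ n, (z ^ n).re ≤ 1 := fun n => (Complex.re_le_norm _).trans (hnorm n)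
  have hzero : HasSum (fun n => (1 - (z ^ n).re) * p n) 0 := by
    simpa [sub_mul] using hsum.sub hre
  have hpow : ∀ n, 0 < p n → z ^ n = 1 := by
    intro n hn
    have h0 := congrFun ((hasSum_zero_iff_of_nonneg
      (fun n => mul_nonneg (sub_nonneg.2 (hre1 n)) (hp n))).1 hzero) n
    have hre_eq : (z ^ n).re = 1 := by
      rcases mul_eq_zero.1 h0 with h | h
      · linarith
      · exact absurd h hn.ne'
    have him : (z ^ n).im = 0 := by
      have h2 : ‖z ^ n‖ ^ 2 ≤ 1 := pow_le_one₀ (norm_nonneg _) (hnorm n)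
      rw [← Complex.normSq_eq_norm_sq, Complex.normSq_apply, hre_eq] at h2
      nlinarith
    exact Complex.ext hre_eq him
  obtain ⟨n, hn, -⟩ := haper 2 le_rfl
  have hn0 : 0 < n := Nat.pos_of_ne_zero fun h => by rw [h, hp0] at hn; exact lt_irrefl _ hn
  have hord : 0 < orderOf z := orderOf_pos_iff.2 (isOfFinOrder_iff_pow_eq_one.2 ⟨n, hn0, hpow n hn⟩)
  by_contra hz1
  have hord1 : orderOf z ≠ 1 := fun h => hz1 (orderOf_eq_one_iff.1 h)
  obtain ⟨m, hm, hdvd⟩ := haper (orderOf z) (by omega)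
  exact hdvd (orderOf_dvd_of_pow_eq_one (hpow m hm))

theorem tsum_pow_mul_tailSeq_ne_zero {p : ℕ → ℝ} (hp0 : p 0 = 0) (hp : ∀ n, 0 ≤ p n)
    (hsum : HasSum p 1) (haper : ∀ N : ℕ, 2 ≤ N → ∃ n, 0 < p n ∧ ¬ N ∣ n)
    (ht : ∀ n, 0 ≤ tailSeq p n) (hts : Summable (tailSeq p)) {z : ℂ} (hz : ‖z‖ ≤ 1) :
    ∑' n, z ^ n * (tailSeq p n : ℂ) ≠ 0 := by
  have hsz : ∀ {b : ℕ → ℝ}, (∀ n, 0 ≤ b n) → Summable b →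
      Summable fun n => z ^ n * (b n : ℂ) := by
    intro b hb hbs
    refine Summable.of_norm_bounded hbs fun n => ?_
    rw [norm_mul, norm_pow, Complex.norm_real, Real.norm_of_nonneg (hb n)]
    exact mul_le_of_le_one_left (hb n) (pow_le_one₀ (norm_nonneg _) hz)
  have hT := hsz ht hts
  intro h0
  have hz1 : z = 1 := by
    refine eq_one_of_tsum_pow_mul_eq_one hp0 hp hsum haper hz ?_
    have hTs := hT.hasSum
    rw [h0] at hTs
    have h1 := (hasSum_nat_add_iff' 1).2 hTs
    have h2 := hTs.mul_left z
    refine (hasSum_nat_add_iff' (f := fun n => z ^ n * (p n : ℂ)) 1).1 ?_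
    have hval : (1 : ℂ) - ∑ i ∈ Finset.range 1, z ^ i * (p i : ℂ) =
        z * 0 - (0 - ∑ i ∈ Finset.range 1, z ^ i * (tailSeq p i : ℂ)) := by
      simp [tailSeq_zero hp0, hp0]
    rw [hval]
    refine (iff_of_eq (congrArg (HasSum · _) (funext fun n => ?_))).2 (h2.sub h1)
    rw [tailSeq_succ]
    push_cast
    ring
  subst hz1
  have h1 : (∑' n, tailSeq p n : ℝ) = 0 := by
    have : ((∑' n, tailSeq p n : ℝ) : ℂ) = 0 := by
      rw [Complex.ofReal_tsum]; simpa using h0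
    exact_mod_cast this
  have h2 := hts.le_tsum 0 fun n _ => ht n
  rw [h1, tailSeq_zero hp0] at h2
  linarith

/-- Geometric convergence in the renewal theorem. -/
theorem exists_fullRenewal_sub_le {p : ℕ → ℝ} (hp0 : p 0 = 0) (hp : ∀ n, 0 ≤ p n)
    (hsum : HasSum p 1) (haper : ∀ N : ℕ, 2 ≤ N → ∃ n, 0 < p n ∧ ¬ N ∣ n) {A r : ℝ}
    (hr0 : 0 < r) (hr1 : r < 1) (ht : ∀ n, 0 ≤ tailSeq p n ∧ tailSeq p n ≤ A * r ^ n) :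
    ∃ c ρ C : ℝ, r < ρ ∧ ρ < 1 ∧ 0 ≤ C ∧ ∀ n, |fullRenewal p n - c| ≤ C * ρ ^ n := by
  have hts : Summable (tailSeq p) := Summable.of_nonneg_of_le (fun n => (ht n).1)
    (fun n => (ht n).2) ((summable_geometric_of_lt_one hr0.le hr1).mul_left A)
  obtain ⟨s, ρ, C, hρ0, hρ1, hs, hinv⟩ := exists_inverse_series_of_geometric_decay
    (fun n => (tailSeq p n : ℂ)) (A := A) hr0 hr1
    (fun n => by rw [Complex.norm_real, Real.norm_of_nonneg (ht n).1]; exact (ht n).2)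
    (fun z hz => tsum_pow_mul_tailSeq_ne_zero hp0 hp hsum haper (fun n => (ht n).1) hts hz)
  have hC : 0 ≤ C := by simpa using (norm_nonneg _).trans (hs 0)
  have hser : PowerSeries.map Complex.ofRealHom (PowerSeries.mk (fullRenewal p)) *
      (1 - PowerSeries.X) = PowerSeries.mk s := by
    have h := congrArg (PowerSeries.map Complex.ofRealHom) (mk_fullRenewal_mul hp0)
    rw [one_sub_mk_eq hp0, ← mul_assoc, map_mul, map_mul, map_sub, map_one,
      PowerSeries.map_X] at h
    have hm : PowerSeries.map Complex.ofRealHom (PowerSeries.mk (tailSeq p)) =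
        PowerSeries.mk fun n => (tailSeq p n : ℂ) := by ext n; simp
    rw [hm] at h
    calc _ = _ * (PowerSeries.mk (fun n => (tailSeq p n : ℂ)) * PowerSeries.mk s) := by
          rw [hinv, mul_one]
      _ = _ := by rw [← mul_assoc, h, one_mul]
  have hdiff : ∀ n, ‖((fullRenewal p (n + 1) - fullRenewal p n : ℝ) : ℂ)‖ = ‖s (n + 1)‖ := by
    intro n
    have h := congrArg (PowerSeries.coeff (n + 1)) hser
    rw [mul_sub, mul_one, map_sub, PowerSeries.coeff_succ_mul_X] at h
    simp only [PowerSeries.coeff_map, PowerSeries.coeff_mk, Complex.ofRealHom_eq_coe] at h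
    rw [← h]; push_cast; rfl
  obtain ⟨ρ', hρ', hρ'1⟩ := exists_between (max_lt hr1 hρ1)
  have hρρ' : ρ < ρ' := (le_max_right _ _).trans_lt hρ'
  have hdist : ∀ n, dist (fullRenewal p n) (fullRenewal p (n + 1)) ≤ C * ρ' ^ n := by
    intro n
    rw [dist_comm, Real.dist_eq, ← Real.norm_eq_abs, ← Complex.norm_real, hdiff]
    refine (hs _).trans (mul_le_mul_of_nonneg_left ?_ hC)
    exact (pow_le_pow_of_le_one hρ0.le hρ1.le n.le_succ).trans
      (pow_le_pow_left₀ hρ0.le hρρ'.le n)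
  obtain ⟨c, hc⟩ := cauchySeq_tendsto_of_complete (cauchySeq_of_le_geometric ρ' C hρ'1 hdist)
  refine ⟨c, ρ', C / (1 - ρ'), (le_max_left _ _).trans_lt hρ', hρ'1,
    div_nonneg hC (by linarith), fun n => ?_⟩
  have h := dist_le_of_le_geometric_of_tendsto ρ' C hρ'1 hdist hc n
  rw [Real.dist_eq] at h
  rwa [div_mul_eq_mul_div]

theorem Kren_eq {π p : ℕ → ℝ} (hπ0 : π 0 = 0) {i j : ℕ} :
    Kren π p i j =
      (∑ k ∈ Finset.range (i + 1), π k * fullRenewal p (i - k)) - Qren p j i := by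
  rw [Kren, Finset.sum_range_succ, Finset.range_eq_Ico]
  congr 1
  have hlast : π i * fullRenewal p (i - i) = π i := by simp [fullRenewal]
  rw [hlast, add_comm]
  congr 1
  rcases Nat.eq_zero_or_pos i with rfl | hi
  · simp
  rw [Finset.sum_eq_sum_Ico_succ_bot hi, hπ0, zero_mul, zero_add]
  refine Finset.sum_congr rfl fun k hk => ?_
  have hk2 := (Finset.mem_Ico.1 hk).2
  rw [fullRenewal, if_neg (by omega)]

/-- The one-point intensity of the delayed renewal process converges geometrically to the limit of
the renewal sequence. -/
theorem exists_delayed_sub_le {π u : ℕ → ℝ} (hπ : ∀ n, 0 ≤ π n) {c r ρ A C : ℝ}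
    (hr0 : 0 < r) (hrρ : r < ρ) (hA : 0 ≤ A) (hC : 0 ≤ C)
    (hπA : ∀ n, π n ≤ A * r ^ n) (ht : ∀ n, 0 ≤ tailSeq π n ∧ tailSeq π n ≤ A * r ^ n)
    (hu : ∀ n, |u n - c| ≤ C * ρ ^ n) :
    ∃ D ≥ 0, ∀ i, |(∑ k ∈ Finset.range (i + 1), π k * u (i - k)) - c| ≤ D * ρ ^ i := by
  have hρ0 : 0 < ρ := hr0.trans hrρ
  have hq1 : r / ρ < 1 := (div_lt_one hρ0).2 hrρ
  have hq0 : 0 ≤ r / ρ := by positivity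
  refine ⟨A * C * (1 - r / ρ)⁻¹ + |c| * A, ?_, fun i => ?_⟩
  · have : 0 < 1 - r / ρ := by linarith
    positivity
  have hsplit : (∑ k ∈ Finset.range (i + 1), π k * u (i - k)) - c =
      (∑ k ∈ Finset.range (i + 1), π k * (u (i - k) - c)) - c * tailSeq π i := by
    simp only [mul_sub, Finset.sum_sub_distrib, ← Finset.sum_mul, tailSeq]
    ring
  have hfirst : |∑ k ∈ Finset.range (i + 1), π k * (u (i - k) - c)| ≤
      A * C * (1 - r / ρ)⁻¹ * ρ ^ i := by
    calc _ ≤ ∑ k ∈ Finset.range (i + 1), A * C * ρ ^ i * (r / ρ) ^ k := by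
          refine (Finset.abs_sum_le_sum_abs _ _).trans (Finset.sum_le_sum fun k hk => ?_)
          have hki : k ≤ i := by simp at hk; omega
          rw [abs_mul, abs_of_nonneg (hπ k)]
          calc π k * |u (i - k) - c| ≤ A * r ^ k * (C * ρ ^ (i - k)) :=
                mul_le_mul (hπA k) (hu _) (abs_nonneg _) (by positivity)
            _ = A * C * ρ ^ i * (r / ρ) ^ k := by
                rw [← pow_sub_mul_pow ρ hki, div_pow]
                field_simp
      _ = A * C * ρ ^ i * ∑ k ∈ Finset.range (i + 1), (r / ρ) ^ k := by rw [Finset.mul_sum]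
      _ ≤ A * C * ρ ^ i * (1 - r / ρ)⁻¹ := by
          refine mul_le_mul_of_nonneg_left ?_ (by positivity)
          rw [← tsum_geometric_of_lt_one hq0 hq1]
          exact (summable_geometric_of_lt_one hq0 hq1).sum_le_tsum _ fun _ _ => by positivity
      _ = _ := by ring
  have hsecond : |c * tailSeq π i| ≤ |c| * A * ρ ^ i := by
    rw [abs_mul, abs_of_nonneg (ht i).1, mul_assoc]
    refine mul_le_mul_of_nonneg_left ((ht i).2.trans ?_) (abs_nonneg _)
    exact mul_le_mul_of_nonneg_left (pow_le_pow_left₀ hr0.le hrρ.le i) hA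
  rw [hsplit, add_mul]
  exact (abs_sub _ _).trans (add_le_add hfirst hsecond)

theorem sum_pow_le_of_injOn {θ : ℝ} (h0 : 0 ≤ θ) (h1 : θ < 1) (G : Finset ℕ) (f : ℕ → ℕ)
    (hf : Set.InjOn f G) : ∑ j ∈ G, θ ^ f j ≤ (1 - θ)⁻¹ := by
  rw [← Finset.sum_image (f := fun n => θ ^ n) hf, ← tsum_geometric_of_lt_one h0 h1]
  exact (summable_geometric_of_lt_one h0 h1).sum_le_tsum _ fun _ _ => by positivity

theorem sum_pow_dist_le {θ : ℝ} (h0 : 0 ≤ θ) (h1 : θ < 1) (G : Finset ℕ) (i : ℕ) :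
    ∑ j ∈ G, θ ^ Nat.dist i j ≤ 2 * (1 - θ)⁻¹ := by
  rw [← Finset.sum_filter_add_sum_filter_not G (fun j => j ≤ i), two_mul]
  refine add_le_add (sum_pow_le_of_injOn h0 h1 _ _ ?_) (sum_pow_le_of_injOn h0 h1 _ _ ?_) <;>
  · intro a ha b hb hab
    simp only [Finset.coe_filter, Set.mem_ofPred_eq] at ha hb
    simp only [Nat.dist] at hab
    omega

/-- Schur's test for a matrix with exponential off-diagonal decay. -/
theorem sum_sq_le_of_pow_dist_bound {κ : ℕ → ℕ → ℝ} {M θ : ℝ} (hM : 0 ≤ M) (h0 : 0 ≤ θ)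
    (h1 : θ < 1) (hκ : ∀ i j, |κ i j| ≤ M * θ ^ Nat.dist i j) (v : ℕ → ℝ) (F G : Finset ℕ) :
    ∑ i ∈ F, (∑ j ∈ G, κ i j * v j) ^ 2 ≤ (M * (2 * (1 - θ)⁻¹)) ^ 2 * ∑ j ∈ G, v j ^ 2 := by
  have h1θ : 0 < 1 - θ := by linarith
  set S : ℝ := M * (2 * (1 - θ)⁻¹)
  have hS0 : 0 ≤ S := by positivity
  have hrow : ∀ i, ∑ j ∈ G, |κ i j| ≤ S := fun i => by
    refine (Finset.sum_le_sum fun j _ => hκ i j).trans ?_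
    rw [← Finset.mul_sum]
    exact mul_le_mul_of_nonneg_left (sum_pow_dist_le h0 h1 G i) hM
  have hcol : ∀ j, ∑ i ∈ F, |κ i j| ≤ S := fun j => by
    refine (Finset.sum_le_sum fun i _ => hκ i j).trans ?_
    simp only [Nat.dist_comm _ j]
    rw [← Finset.mul_sum]
    exact mul_le_mul_of_nonneg_left (sum_pow_dist_le h0 h1 F j) hM
  calc ∑ i ∈ F, (∑ j ∈ G, κ i j * v j) ^ 2
      ≤ ∑ i ∈ F, S * ∑ j ∈ G, |κ i j| * v j ^ 2 := by
        refine Finset.sum_le_sum fun i _ => ?_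
        refine (Finset.sum_sq_le_sum_mul_sum_of_sq_le_mul G (f := fun j => |κ i j|)
          (g := fun j => |κ i j| * v j ^ 2) (fun _ _ => abs_nonneg _)
          (fun _ _ => by positivity) fun j _ => ?_).trans ?_
        · rw [mul_pow, ← mul_assoc, ← sq, sq_abs]
        · exact mul_le_mul_of_nonneg_right (hrow i)
            (Finset.sum_nonneg fun _ _ => by positivity)
    _ = S * ∑ j ∈ G, (∑ i ∈ F, |κ i j|) * v j ^ 2 := by
        rw [← Finset.mul_sum, Finset.sum_comm]
        simp only [Finset.sum_mul]
    _ ≤ S * ∑ j ∈ G, S * v j ^ 2 := by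
        refine mul_le_mul_of_nonneg_left (Finset.sum_le_sum fun j _ => ?_) hS0
        exact mul_le_mul_of_nonneg_right (hcol j) (sq_nonneg _)
    _ = S ^ 2 * ∑ j ∈ G, v j ^ 2 := by rw [← Finset.mul_sum]; ring

/-- Conjugation by an exponential diagonal matrix does not change determinants. -/
theorem det_exp_conj {n : ℕ} (α : ℝ) (y : Fin n → ℝ) (B : Matrix (Fin n) (Fin n) ℝ) :
    Matrix.det (Matrix.of fun i j => Real.exp (α * (y i - y j)) * B i j) = B.det := by
  have h : (Matrix.of fun i j => Real.exp (α * (y i - y j)) * B i j) =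
      Matrix.of fun i j => Real.exp (α * y i) *
        (Matrix.of fun i j => Real.exp (-(α * y j)) * B i j) i j := by
    ext i j
    rw [Matrix.of_apply, Matrix.of_apply, Matrix.of_apply, ← mul_assoc, ← Real.exp_add]
    congr 2
    ring
  rw [h, Matrix.det_mul_column, Matrix.det_mul_row, ← mul_assoc, ← Finset.prod_mul_distrib]
  simp [← Real.exp_add]

/-- Off-diagonal decay of the delayed renewal kernel after conjugation. -/
theorem exists_conj_Kren_le {π p : ℕ → ℝ} (hπ0 : π 0 = 0) {c ρ C D : ℝ} (hρ0 : 0 < ρ)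
    (hρ1 : ρ < 1) (hC : 0 ≤ C) (hD : 0 ≤ D) (hu : ∀ n, |fullRenewal p n - c| ≤ C * ρ ^ n)
    (hw : ∀ i, |(∑ k ∈ Finset.range (i + 1), π k * fullRenewal p (i - k)) - c| ≤ D * ρ ^ i) :
    ∃ α > (0 : ℝ), ∃ θ M : ℝ, 0 < θ ∧ θ < 1 ∧ 0 < M ∧ ∀ i j : ℕ,
      |Real.exp (α * ((i : ℝ) - j)) * Kren π p i j| ≤ M * θ ^ Nat.dist i j := by
  have hθ0 : 0 < √ρ := Real.sqrt_pos.2 hρ0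
  have hθ1 : √ρ < 1 := by rw [Real.sqrt_lt' one_pos]; simpa using hρ1
  have hsq : √ρ ^ 2 = ρ := Real.sq_sqrt hρ0.le
  set θ := √ρ
  refine ⟨-Real.log θ, neg_pos.2 (Real.log_neg hθ0 hθ1), θ, C + D + |c| + 1, hθ0, hθ1,
    by positivity, fun i j => ?_⟩
  have hexp : Real.exp (-Real.log θ * ((i : ℝ) - j)) * θ ^ i = θ ^ j := by
    have h : ∀ n : ℕ, θ ^ n = Real.exp (Real.log θ * n) := fun n => by
      rw [mul_comm, Real.exp_nat_mul, Real.exp_log hθ0]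
    rw [h i, h j, ← Real.exp_add]
    congr 1
    ring
  rw [abs_mul, Real.abs_exp, Kren_eq hπ0, Qren]
  set E := Real.exp (-Real.log θ * ((i : ℝ) - j))
  have hE : 0 ≤ E := Real.exp_nonneg _
  have hwi := hw i
  set w := ∑ k ∈ Finset.range (i + 1), π k * fullRenewal p (i - k)
  have hi1 : ρ ^ i ≤ 1 := pow_le_one₀ hρ0.le hρ1.le
  rcases lt_or_ge j i with hij | hij
  · obtain ⟨d, rfl⟩ := Nat.exists_eq_add_of_lt hij
    have hd : j + d + 1 - j = d + 1 := by omega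
    have hEd : E * θ ^ (d + 1) = 1 := by
      rw [add_assoc, pow_add] at hexp
      have hj : θ ^ j ≠ 0 := by positivity
      refine mul_left_cancel₀ hj ?_
      linarith
    have hud := hu (d + 1)
    rw [fullRenewal, if_neg d.succ_ne_zero] at hud
    rw [if_pos hij, hd]
    have hdist : Nat.dist (j + d + 1) j = d + 1 := by rw [Nat.dist]; omega
    rw [hdist]
    have hle : ρ ^ (j + d + 1) ≤ ρ ^ (d + 1) := pow_le_pow_of_le_one hρ0.le hρ1.le (by omega)
    have hb : |w - renewalSeq p (d + 1)| ≤ (C + D + |c| + 1) * ρ ^ (d + 1) := by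
      have htri := abs_sub_le w c (renewalSeq p (d + 1))
      rw [abs_sub_comm c] at htri
      have hDle := mul_le_mul_of_nonneg_left hle hD
      have hpos : 0 ≤ (|c| + 1) * ρ ^ (d + 1) := by positivity
      nlinarith
    calc E * |w - renewalSeq p (d + 1)|
        ≤ E * ((C + D + |c| + 1) * ρ ^ (d + 1)) := mul_le_mul_of_nonneg_left hb hE
      _ = (C + D + |c| + 1) * θ ^ (d + 1) * (E * θ ^ (d + 1)) := by
          rw [← hsq, ← pow_mul, mul_comm 2, pow_mul]; ring
      _ = _ := by rw [hEd, mul_one]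
  · obtain ⟨d, rfl⟩ := Nat.exists_eq_add_of_le hij
    have hdist : Nat.dist i (i + d) = d := by rw [Nat.dist]; omega
    have hEd : E = θ ^ d := by
      rw [pow_add, mul_comm] at hexp
      exact mul_left_cancel₀ (by positivity) hexp
    rw [if_neg (by omega), sub_zero, hdist, hEd, mul_comm]
    refine mul_le_mul_of_nonneg_right ?_ (by positivity)
    have htri := abs_sub_le w c 0
    rw [sub_zero, sub_zero] at htri
    have := mul_le_mul_of_nonneg_left hi1 hD
    linarith

/-- Main content of Theorem 4.1: for a delayed renewal process with delay
distribution `π` and aperiodic step distribution `p`, both of class `𝓔`, the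
conjugated kernel `K̃ i j = e^{α(i-j)} K i j` (for suitable `α > 0`) defines a
bounded operator on `ℓ²(ℤ_{>0})` (formulated via finite partial sums: for every
finitely supported `v` vanishing at `0`, `‖K̃v‖² ≤ C²‖v‖²`), and has the same
principal minors as `K`, so it is also a correlation kernel for the delayed
renewal process. -/
theorem delayed_renewal_kernel_bounded (π p : ℕ → ℝ)
    (hπ0 : π 0 = 0) (hπnonneg : ∀ n, 0 ≤ π n) (hπle : ∀ n, π n ≤ 1)
    (hπsum : ∑' n, π n = 1)
    (hp0 : p 0 = 0) (hpnonneg : ∀ n, 0 ≤ p n) (hple : ∀ n, p n ≤ 1)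
    (hpsum : ∑' n, p n = 1)
    (r : ℝ) (hr : r ∈ Set.Ioo (0 : ℝ) 1) (N₀ : ℕ)
    (hπtail : ∀ n ≥ N₀, π n ≤ r ^ n) (hptail : ∀ n ≥ N₀, p n ≤ r ^ n)
    (haper : ∀ N : ℕ, 2 ≤ N → ∃ n, 0 < p n ∧ ¬ N ∣ n) :
    ∃ α > (0 : ℝ), ∃ C > (0 : ℝ),
      (∀ v : ℕ → ℝ, v 0 = 0 → (Function.support v).Finite → ∀ F : Finset ℕ,
        (∑ i ∈ F, (∑' j : ℕ, Real.exp (α * ((i : ℝ) - (j : ℝ))) * Kren π p i j * v j) ^ 2) ≤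
          C ^ 2 * ∑' j, (v j) ^ 2) ∧
      (∀ (n : ℕ) (y : Fin n → ℕ), (∀ i, 1 ≤ y i) →
        Matrix.det (Matrix.of fun i j : Fin n =>
            Real.exp (α * ((y i : ℝ) - (y j : ℝ))) * Kren π p (y i) (y j)) =
          Matrix.det (Matrix.of fun i j : Fin n => Kren π p (y i) (y j))) := by
  obtain ⟨hr0, hr1⟩ := hr
  have hp : HasSum p 1 := by
    rw [← hpsum]
    refine Summable.hasSum (by_contra fun h => ?_)
    rw [tsum_eq_zero_of_not_summable h] at hpsum
    exact zero_ne_one hpsum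
  obtain ⟨A, -, -, hpt⟩ := exists_geometric_bound hpnonneg hple hpsum hr0 hr1 hptail
  obtain ⟨B, hB, hπB, hπt⟩ := exists_geometric_bound hπnonneg hπle hπsum hr0 hr1 hπtail
  obtain ⟨c, ρ, C, hrρ, hρ1, hC, hu⟩ :=
    exists_fullRenewal_sub_le hp0 hpnonneg hp haper hr0 hr1 hpt
  obtain ⟨D, hD, hw⟩ := exists_delayed_sub_le hπnonneg hr0 hrρ hB.le hC hπB hπt hu
  obtain ⟨α, hα, θ, M, hθ0, hθ1, hM, hK⟩ :=
    exists_conj_Kren_le hπ0 (hr0.trans hrρ) hρ1 hC hD hu hw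
  have h1θ : 0 < 1 - θ := by linarith
  refine ⟨α, hα, M * (2 * (1 - θ)⁻¹), by positivity, fun v _ hv F => ?_, fun n y _ =>
    det_exp_conj α (fun i => (y i : ℝ)) (Matrix.of fun i j => Kren π p (y i) (y j))⟩
  have hv0 : ∀ j ∉ hv.toFinset, v j = 0 := fun j hj => by simpa using hj
  rw [tsum_eq_sum (s := hv.toFinset) fun j hj => by rw [hv0 j hj]; ring]
  have hsum : ∀ i : ℕ, ∑' j : ℕ, Real.exp (α * ((i : ℝ) - (j : ℝ))) * Kren π p i j * v j =
      ∑ j ∈ hv.toFinset, Real.exp (α * ((i : ℝ) - (j : ℝ))) * Kren π p i j * v j := fun i =>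
    tsum_eq_sum fun j hj => by rw [hv0 j hj, mul_zero]
  simp only [hsum]
  exact sum_sq_le_of_pow_dist_bound hM.le hθ0.le hθ1 hK v F hv.toFinset
end
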